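/- arXiv:1708.00464 — 14 statements merged into one kernel-verified Lean document; each statement's English description precedes it below -/
import Mathlib

section
/- If f : X → [-∞,+∞] solves the fixed point equation (FP), then f admits the quadratic lower bound f(x) ≥ (1/2)⟨(2τ/(τ+1))Ex, x⟩ + ⟨(τ/(τ+1))((1/τ)w + c), x⟩ + β/(τ+1) for all x ∈ X. -/
open scoped RealInnerProductSpace

/-- The Legendre–Fenchel conjugate of an extended-real-valued function on a real
Hilbert space: `f*(y) = sup_x (⟪y, x⟫ - f x)`. -/
noncomputable def fenchelConj {X : Type*} [NormedAddCommGroup X] [InnerProductSpace ℝ X]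
    (f : X → EReal) : X → EReal :=
  fun y => ⨆ x : X, ((⟪y, x⟫ : ℝ) : EReal) - f x

/-- `f` solves the fixed point equation (FP):
`f x = τ · f*(E x + c) + ⟪w, x⟫ + β` for every `x`. -/
def SolvesFP {X : Type*} [NormedAddCommGroup X] [InnerProductSpace ℝ X]
    (τ : ℝ) (c w : X) (β : ℝ) (E : X ≃L[ℝ] X) (f : X → EReal) : Prop :=
  ∀ x : X, f x = (τ : EReal) * fenchelConj f (E x + c) + ((⟪w, x⟫ : ℝ) : EReal) + (β : EReal)

/-- any solution of (FP) admits the quadratic lower bound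
`f(x) ≥ (1/2)⟪(2τ/(τ+1))Ex, x⟫ + ⟪(τ/(τ+1))((1/τ)w + c), x⟫ + β/(τ+1)`. -/
theorem solution_of_FP_quadratic_lower_bound
    {X : Type*} [NormedAddCommGroup X] [InnerProductSpace ℝ X] [CompleteSpace X] [Nontrivial X]
    (τ : ℝ) (hτ : 0 < τ) (c w : X) (β : ℝ) (E : X ≃L[ℝ] X)
    (f : X → EReal) (hf : SolvesFP τ c w β E f) :
    ∀ x : X,
      (((1 : ℝ) / 2 * ⟪(2 * τ / (τ + 1)) • E x, x⟫
          + ⟪(τ / (τ + 1)) • ((1 / τ) • w + c), x⟫ + β / (τ + 1) : ℝ) : EReal) ≤ f x := by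
  intro x
  have h := hf x
  have h1 : ((⟪E x + c, x⟫ : ℝ) : EReal) - f x ≤ fenchelConj f (E x + c) :=
    le_iSup (fun z : X => ((⟪E x + c, z⟫ : ℝ) : EReal) - f z) x
  have hτ' : (0 : EReal) ≤ (τ : EReal) := by exact_mod_cast hτ.le
  have h2 : (τ : EReal) * (((⟪E x + c, x⟫ : ℝ) : EReal) - f x) + ((⟪w, x⟫ : ℝ) : EReal)
      + (β : EReal) ≤ f x := by
    conv_rhs => rw [h]
    gcongr
  clear h h1
  generalize f x = a at h2 ⊢
  induction a with
  | top => exact le_top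
  | bot =>
    exfalso
    rw [EReal.coe_sub_bot, EReal.coe_mul_top_of_pos hτ, EReal.top_add_coe,
      EReal.top_add_coe] at h2
    simp at h2
  | coe a =>
    have h3 : τ * (⟪E x + c, x⟫ - a) + ⟪w, x⟫ + β ≤ a := by exact_mod_cast h2
    rw [EReal.coe_le_coe_iff]
    simp only [inner_add_left, real_inner_smul_left] at h3 ⊢
    have hp : 0 < τ + 1 := by linarith
    have key : (1 : ℝ) / 2 * (2 * τ / (τ + 1) * ⟪E x, x⟫)
        + τ / (τ + 1) * (1 / τ * ⟪w, x⟫ + ⟪c, x⟫) + β / (τ + 1)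
        = (τ * (⟪E x, x⟫ + ⟪c, x⟫) + ⟪w, x⟫ + β) / (τ + 1) := by
      field_simp
      ring
    rw [key, div_le_iff₀ hp]
    linarith
end

section
/- Let L : X → X be a single-valued bijective map that is strictly monotone and maximal monotone, and let Q : X → 2^X be a monotone set-valued operator. If the identity operator I is contained (as a graph) in the composition QLQL, or if I is contained in LQLQ, then Q = L⁻¹; in particular Q is single-valued, invertible, strictly monotone and maximal monotone. -/
open scoped RealInnerProductSpace

/-- A set-valued operator `Q : X → 2^X` is monotone. -/
def SVMonotone {X : Type*} [NormedAddCommGroup X] [InnerProductSpace ℝ X]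
    (Q : X → Set X) : Prop :=
  ∀ ⦃x₁ x₂ y₁ y₂ : X⦄, y₁ ∈ Q x₁ → y₂ ∈ Q x₂ → 0 ≤ (⟪y₂ - y₁, x₂ - x₁⟫ : ℝ)

/-- A set-valued operator `Q : X → 2^X` is strictly monotone. -/
def SVStrictlyMonotone {X : Type*} [NormedAddCommGroup X] [InnerProductSpace ℝ X]
    (Q : X → Set X) : Prop :=
  ∀ ⦃x₁ x₂ y₁ y₂ : X⦄, y₁ ∈ Q x₁ → y₂ ∈ Q x₂ → x₁ ≠ x₂ → 0 < (⟪y₂ - y₁, x₂ - x₁⟫ : ℝ)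

/-- A set-valued operator is maximal monotone: it is monotone and its graph is not
properly contained in the graph of any monotone operator. -/
def SVMaximalMonotone {X : Type*} [NormedAddCommGroup X] [InnerProductSpace ℝ X]
    (Q : X → Set X) : Prop :=
  SVMonotone Q ∧ ∀ B : X → Set X, SVMonotone B → (∀ x, Q x ⊆ B x) → B = Q

/-- Composition of set-valued operators: `(B ∘ A)(x) = ⋃_{y ∈ A x} B y`. -/
def SVComp {X : Type*} (B A : X → Set X) : X → Set X := fun x => ⋃ y ∈ A x, B y

/-- if `L` is single-valued, bijective, strictly monotone and maximal
monotone, `Q` is a monotone set-valued operator, and `I ⊆ QLQL` or `I ⊆ LQLQ`, then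
`Q = L⁻¹`; in particular `Q` is single-valued, invertible, strictly monotone and maximal
monotone. -/
theorem QLQL_or_LQLQ_contains_identity_implies_Q_eq_Linv
    {X : Type*} [NormedAddCommGroup X] [InnerProductSpace ℝ X] [CompleteSpace X] [Nontrivial X]
    (L : X → X) (hLbij : Function.Bijective L)
    (hLstrict : ∀ x₁ x₂ : X, x₁ ≠ x₂ → 0 < (⟪L x₂ - L x₁, x₂ - x₁⟫ : ℝ))
    (hLmax : SVMaximalMonotone (fun x => ({L x} : Set X)))
    (Q : X → Set X) (hQ : SVMonotone Q)
    (hI : (∀ x : X, x ∈ SVComp Q (SVComp (fun z => ({L z} : Set X))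
              (SVComp Q (fun z => ({L z} : Set X)))) x) ∨
          (∀ x : X, x ∈ SVComp (fun z => ({L z} : Set X))
              (SVComp Q (SVComp (fun z => ({L z} : Set X)) Q)) x)) :
    Q = (fun y => {x : X | L x = y}) ∧
      (∃ g : X → X, Function.Bijective g ∧ ∀ y : X, Q y = {g y}) ∧
      SVStrictlyMonotone Q ∧ SVMaximalMonotone Q := by
  have hfix : ∀ a b : X, a ∈ Q (L b) → b ∈ Q (L a) → a = b := by
    intro a b h1 h2
    by_contra hne
    have h3 := hQ h1 h2
    have h4 := hLstrict a b hne
    have h5 : (⟪b - a, L a - L b⟫ : ℝ) = - ⟪L b - L a, b - a⟫ := by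
      rw [real_inner_comm, ← inner_neg_left, neg_sub]
    linarith
  have hsub : ∀ x : X, x ∈ Q (L x) := by
    intro x
    rcases hI with h | h
    · have hx := h x
      simp only [SVComp, Set.mem_iUnion, Set.mem_singleton_iff, exists_prop] at hx
      obtain ⟨_, ⟨u, ⟨_, rfl, hu⟩, rfl⟩, hx⟩ := hx
      have := hfix u x hu hx
      subst this
      exact hu
    · have hx := h (L x)
      simp only [SVComp, Set.mem_iUnion, Set.mem_singleton_iff, exists_prop] at hx
      obtain ⟨b, ⟨_, ⟨a, ha, rfl⟩, hb⟩, hx⟩ := hx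
      have hbx : x = b := hLbij.1 hx
      subst hbx
      have := hfix a x ha hb
      subst this
      exact ha
  have hmax : ∀ B : X → Set X, SVMonotone B → (∀ x, x ∈ B (L x)) →
      B = (fun y => {x : X | L x = y}) := by
    intro B hB hLB
    have h := hLmax.2 (fun x => {y | x ∈ B y})
      (by
        intro x₁ x₂ y₁ y₂ h1 h2
        rw [real_inner_comm]
        exact hB h1 h2)
      (by
        intro x y hy
        rw [Set.mem_singleton_iff] at hy
        subst hy
        exact hLB x)
    funext y
    ext x
    have hx : y ∈ (fun x => {y | x ∈ B y}) x ↔ y ∈ ({L x} : Set X) := by rw [h]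
    simp only [Set.mem_setOf_eq, Set.mem_singleton_iff] at hx ⊢
    rw [hx, eq_comm]
  have hQeq := hmax Q hQ hsub
  refine ⟨hQeq, ?_, ?_, hQ, ?_⟩
  · let e := Equiv.ofBijective L hLbij
    refine ⟨e.symm, e.symm.bijective, fun y => ?_⟩
    rw [hQeq]
    ext x
    simp only [Set.mem_setOf_eq, Set.mem_singleton_iff]
    rw [Equiv.eq_symm_apply]
    rfl
  · intro x₁ x₂ y₁ y₂ h1 h2 hne
    rw [hQeq] at h1 h2
    simp only [Set.mem_setOf_eq] at h1 h2
    subst h1 h2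
    rw [real_inner_comm]
    exact hLstrict y₁ y₂ (fun h => hne (by rw [h]))
  · intro B hB hs
    rw [hQeq]
    exact hmax B hB (fun x => hs _ (hsub x))
end

section
/- Let L : X → X be a single-valued bijective map that is strictly monotone and maximal monotone. If Q : X → 2^X is monotone, Q(x) ≠ ∅ for every x ∈ X, and LQL = Q⁻¹ (equality of set-valued operators, i.e., of graphs), then Q = L⁻¹. In other words, Q = L⁻¹ is the unique solution of the equation LQL = Q⁻¹ in the set of monotone set-valued operators on X with nonempty values everywhere. -/
open scoped RealInnerProductSpace

/-- Inverse of a set-valued operator: `Q⁻¹(y) = {x : y ∈ Q x}`. -/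
def SVInv {X : Type*} (Q : X → Set X) : X → Set X := fun y => {x : X | y ∈ Q x}

/-- if `L` is single-valued, bijective, strictly monotone and maximal
monotone, and `Q` is monotone with nonempty values and satisfies `LQL = Q⁻¹`, then
`Q = L⁻¹`. In other words, `Q = L⁻¹` is the unique solution of `LQL = Q⁻¹` in the class
of monotone set-valued operators with everywhere nonempty values. -/
theorem LQL_eq_Qinv_unique_solution
    {X : Type*} [NormedAddCommGroup X] [InnerProductSpace ℝ X] [CompleteSpace X] [Nontrivial X]
    (L : X → X) (hLbij : Function.Bijective L)
    (hLstrict : ∀ x₁ x₂ : X, x₁ ≠ x₂ → 0 < (⟪L x₂ - L x₁, x₂ - x₁⟫ : ℝ))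
    (hLmax : SVMaximalMonotone (fun x => ({L x} : Set X)))
    (Q : X → Set X) (hQmono : SVMonotone Q) (hQne : ∀ x : X, (Q x).Nonempty)
    (hQeq : SVComp (fun z => ({L z} : Set X)) (SVComp Q (fun z => ({L z} : Set X)))
      = SVInv Q) :
    Q = (fun y => {x : X | L x = y}) ∧
      SVMonotone (fun y => {x : X | L x = y}) ∧
      (∀ y : X, ({x : X | L x = y} : Set X).Nonempty) ∧
      SVComp (fun z => ({L z} : Set X))
          (SVComp (fun y => {x : X | L x = y}) (fun z => ({L z} : Set X)))
        = SVInv (fun y => {x : X | L x = y}) := by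
  have key : ∀ x w : X, w ∈ Q (L x) → x ∈ Q (L w) := by
    intro x w h
    have h1 : L w ∈ SVComp (fun z => ({L z} : Set X)) (SVComp Q (fun z => ({L z} : Set X))) x := by
      simp only [SVComp, Set.mem_iUnion, Set.mem_singleton_iff]
      exact ⟨w, ⟨L x, rfl, h⟩, rfl⟩
    rw [hQeq] at h1
    exact h1
  have key2 : ∀ x w : X, w ∈ Q (L x) → w = x := by
    intro x w h
    by_contra hne
    have h1 := hQmono h (key x w h)
    have h2 := hLstrict w x hne
    have h3 : (⟪x - w, L w - L x⟫ : ℝ) = - ⟪L x - L w, x - w⟫ := by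
      rw [real_inner_comm, ← inner_neg_left, neg_sub]
    linarith
  refine ⟨?_, ?_, ?_, ?_⟩
  · funext y
    obtain ⟨x, rfl⟩ := hLbij.2 y
    ext w
    constructor
    · intro h
      exact congrArg L (key2 x w h)
    · intro h
      have hw : w = x := hLbij.1 h
      subst hw
      obtain ⟨v, hv⟩ := hQne (L w)
      have := key2 w v hv
      rwa [this] at hv
  · intro y₁ y₂ x₁ x₂ h₁ h₂
    have e₁ : L x₁ = y₁ := h₁
    have e₂ : L x₂ = y₂ := h₂
    subst e₁ e₂
    rw [real_inner_comm]
    exact hLmax.1 rfl rfl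
  · exact fun y => hLbij.2 y
  · funext x
    ext u
    simp only [SVComp, SVInv, Set.mem_iUnion, Set.mem_singleton_iff, Set.mem_setOf_eq]
    constructor
    · rintro ⟨w, ⟨y, rfl, h⟩, rfl⟩
      exact h.symm
    · intro h
      exact ⟨x, ⟨L x, rfl, rfl⟩, h.symm⟩
end

section
/- Suppose f : X → ℝ has the form f(x) = (1/2)⟨Ax, x⟩ + ⟨b, x⟩ + γ where A : X → X is an invertible positive semidefinite continuous linear operator, b ∈ X and γ ∈ ℝ. If f solves the fixed point equation (FP), then A = τE*A⁻¹E, (τE*A⁻¹ + I)b = w + τE*A⁻¹c, and γ = (β + (τ/2)⟨c − b, A⁻¹(c − b)⟩)/(τ + 1) (where E* is the adjoint of E). Conversely, if E is self-adjoint and these three relations hold, then f solves (FP), and moreover (√τ·A⁻¹E)² = I = ((1/√τ)·E⁻¹A)². -/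
open scoped RealInnerProductSpace

/-- for a quadratic function `f(x) = (1/2)⟪Ax,x⟫ + ⟪b,x⟫ + γ` with `A`
invertible positive semidefinite: if `f` solves (FP) then the three coefficient relations
`A = τE*A⁻¹E`, `(τE*A⁻¹ + I)b = w + τE*A⁻¹c` and
`γ = (β + (τ/2)⟪c−b, A⁻¹(c−b)⟫)/(τ+1)` hold; conversely, if `E` is self-adjoint and these
relations hold, then `f` solves (FP) and `(√τ·A⁻¹E)² = I = ((1/√τ)·E⁻¹A)²`. -/
theorem quadratic_solution_coefficient_relations
    {X : Type*} [NormedAddCommGroup X] [InnerProductSpace ℝ X] [CompleteSpace X] [Nontrivial X]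
    (τ : ℝ) (hτ : 0 < τ) (c w : X) (β : ℝ) (E : X ≃L[ℝ] X)
    (A : X ≃L[ℝ] X)
    (hA_sa : ∀ x y : X, (⟪A x, y⟫ : ℝ) = ⟪x, A y⟫)
    (hA_psd : ∀ x : X, 0 ≤ (⟪A x, x⟫ : ℝ))
    (b : X) (γ : ℝ) (f : X → EReal)
    (hf_def : ∀ x : X,
      f x = (((1 : ℝ) / 2 * ⟪A x, x⟫ + ⟪b, x⟫ + γ : ℝ) : EReal)) :
    (SolvesFP τ c w β E f →
      (∀ x : X, A x
          = τ • (ContinuousLinearMap.adjoint (E : X →L[ℝ] X)) (A.symm (E x))) ∧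
      τ • (ContinuousLinearMap.adjoint (E : X →L[ℝ] X)) (A.symm b) + b
          = w + τ • (ContinuousLinearMap.adjoint (E : X →L[ℝ] X)) (A.symm c) ∧
      γ = (β + τ / 2 * ⟪c - b, A.symm (c - b)⟫) / (τ + 1)) ∧
    (IsSelfAdjoint (E : X →L[ℝ] X) →
      (∀ x : X, A x
          = τ • (ContinuousLinearMap.adjoint (E : X →L[ℝ] X)) (A.symm (E x))) →
      τ • (ContinuousLinearMap.adjoint (E : X →L[ℝ] X)) (A.symm b) + b
          = w + τ • (ContinuousLinearMap.adjoint (E : X →L[ℝ] X)) (A.symm c) →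
      γ = (β + τ / 2 * ⟪c - b, A.symm (c - b)⟫) / (τ + 1) →
      SolvesFP τ c w β E f ∧
        (∀ x : X, Real.sqrt τ • A.symm (E (Real.sqrt τ • A.symm (E x))) = x) ∧
        (∀ x : X,
          (Real.sqrt τ)⁻¹ • E.symm (A ((Real.sqrt τ)⁻¹ • E.symm (A x))) = x)) := by
  have hS : ∀ x y : X, (⟪A.symm x, y⟫ : ℝ) = ⟪x, A.symm y⟫ := by
    intro x y
    have := hA_sa (A.symm x) (A.symm y)
    simpa using this.symm
  have hconj : ∀ y : X, fenchelConj f y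
      = (((1 : ℝ) / 2 * ⟪y - b, A.symm (y - b)⟫ - γ : ℝ) : EReal) := by
    intro y
    unfold fenchelConj
    apply le_antisymm
    · apply iSup_le
      intro x
      rw [hf_def, ← EReal.coe_sub, EReal.coe_le_coe_iff]
      have h := hA_psd (x - A.symm (y - b))
      have h1 : (⟪A x, A.symm (y - b)⟫ : ℝ) = ⟪x, y - b⟫ := by
        rw [hA_sa]; simp
      have h2 : (⟪y, x⟫ : ℝ) = ⟪y - b, x⟫ + ⟪b, x⟫ := by
        rw [inner_sub_left]; ring
      rw [map_sub, ContinuousLinearEquiv.apply_symm_apply, inner_sub_left, inner_sub_right,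
        inner_sub_right, h1, real_inner_comm (y - b) x] at h
      rw [h2]
      linarith
    · refine le_trans (le_of_eq ?_) (le_iSup _ (A.symm (y - b)))
      rw [hf_def, ← EReal.coe_sub, EReal.coe_eq_coe_iff, ContinuousLinearEquiv.apply_symm_apply]
      have h2 : (⟪y, A.symm (y - b)⟫ : ℝ) = ⟪y - b, A.symm (y - b)⟫ + ⟪b, A.symm (y - b)⟫ := by
        rw [← inner_add_left]; simp
      rw [h2]
      ring
  have hexp : ∀ x : X, (⟪E x + c - b, A.symm (E x + c - b)⟫ : ℝ)
      = ⟪E x, A.symm (E x)⟫ + 2 * ⟪E x, A.symm (c - b)⟫ + ⟪c - b, A.symm (c - b)⟫ := by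
    intro x
    rw [add_sub_assoc, map_add, inner_add_left, inner_add_right, inner_add_right,
      ← hS (c - b) (E x), real_inner_comm (E x) (A.symm (c - b))]
    ring
  have hFP : SolvesFP τ c w β E f ↔ ∀ x : X,
      (1 : ℝ) / 2 * ⟪A x, x⟫ + ⟪b, x⟫ + γ
        = τ * (1 / 2 * (⟪E x, A.symm (E x)⟫ + 2 * ⟪E x, A.symm (c - b)⟫
          + ⟪c - b, A.symm (c - b)⟫) - γ) + ⟪w, x⟫ + β := by
    unfold SolvesFP
    refine forall_congr' fun x => ?_
    rw [hf_def, hconj, ← EReal.coe_mul, ← EReal.coe_add, ← EReal.coe_add,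
      EReal.coe_eq_coe_iff, hexp]
  have hadj : ∀ u v : X, (⟪(ContinuousLinearMap.adjoint (E : X →L[ℝ] X)) u, v⟫ : ℝ)
      = ⟪u, E v⟫ := by
    intro u v
    rw [ContinuousLinearMap.adjoint_inner_left]; rfl
  have hτ1 : τ + 1 ≠ 0 := by positivity
  rw [hFP]
  refine ⟨fun h => ?_, fun hE h1 h2 h3 => ?_⟩
  · have h0 : γ = (β + τ / 2 * ⟪c - b, A.symm (c - b)⟫) / (τ + 1) := by
      have := h 0
      simp only [map_zero, inner_zero_left, inner_zero_right] at this
      rw [eq_div_iff hτ1]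
      linarith
    rw [eq_div_iff hτ1] at h0
    have hq : ∀ x : X, (⟪A x, x⟫ : ℝ) = τ * ⟪E x, A.symm (E x)⟫ := by
      intro x
      have e1 := h x
      have e2 := h (-x)
      simp only [map_neg, inner_neg_left, inner_neg_right, neg_neg] at e2
      linarith
    have hl : ∀ x : X, (⟪b, x⟫ : ℝ) = τ * ⟪E x, A.symm (c - b)⟫ + ⟪w, x⟫ := by
      intro x
      have e1 := h x
      have e2 := hq x
      linarith
    refine ⟨fun x => ?_, ?_, ?_⟩
    · refine ext_inner_right ℝ fun y => ?_
      rw [real_inner_smul_left, hadj, hS]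
      have e := hq (x + y)
      have ex := hq x
      have ey := hq y
      simp only [map_add, inner_add_left, inner_add_right] at e
      have s1 : (⟪A y, x⟫ : ℝ) = ⟪A x, y⟫ := by rw [hA_sa, real_inner_comm]
      have s2 : (⟪E y, A.symm (E x)⟫ : ℝ) = ⟪E x, A.symm (E y)⟫ := by
        rw [← hS, real_inner_comm]
      rw [s1, s2] at e
      linarith
    · refine ext_inner_right ℝ fun y => ?_
      have e := hl y
      rw [inner_add_left, inner_add_left, real_inner_smul_left, real_inner_smul_left, hadj, hadj,
        real_inner_comm (E y), real_inner_comm (E y)]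
      rw [map_sub, inner_sub_right] at e
      linarith
    · rw [eq_div_iff hτ1]; exact h0
  · have hEE : ∀ x : X, A x = τ • E (A.symm (E x)) := by
      intro x
      have e := h1 x
      rw [hE.adjoint_eq] at e
      exact e
    have hs : Real.sqrt τ * Real.sqrt τ = τ := Real.mul_self_sqrt hτ.le
    have hs0 : Real.sqrt τ ≠ 0 := (Real.sqrt_pos.2 hτ).ne'
    have key : ∀ x : X, Real.sqrt τ • A.symm (E (Real.sqrt τ • A.symm (E x))) = x := by
      intro x
      rw [map_smul, map_smul, smul_smul, hs, ← map_smul, ← hEE]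
      simp
    refine ⟨fun x => ?_, key, fun x => ?_⟩
    · have q : (⟪A x, x⟫ : ℝ) = τ * ⟪E x, A.symm (E x)⟫ := by
        conv_lhs => rw [h1 x]
        rw [real_inner_smul_left, hadj, real_inner_comm]
      have l := congrArg (fun z => (⟪z, x⟫ : ℝ)) h2
      simp only [inner_add_left, real_inner_smul_left, hadj] at l
      rw [eq_div_iff hτ1] at h3
      have e : (⟪E x, A.symm (c - b)⟫ : ℝ) = ⟪A.symm c, E x⟫ - ⟪A.symm b, E x⟫ := by
        rw [map_sub, real_inner_comm, inner_sub_left]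
      rw [q, e]
      linarith
    · obtain ⟨z, rfl⟩ : ∃ z, x = Real.sqrt τ • A.symm (E (Real.sqrt τ • A.symm (E z))) :=
        ⟨x, (key x).symm⟩
      simp only [map_smul, ContinuousLinearEquiv.apply_symm_apply,
        ContinuousLinearEquiv.symm_apply_apply, smul_smul]
      field_simp
      have k := key z
      rw [map_smul, map_smul, smul_smul, ← pow_two] at k
      simpa using k.symm
end

section
/- Assume E is positive definite and f : X → ℝ has the form f(x) = (1/2)⟨Ax, x⟩ + ⟨b, x⟩ + γ with A an invertible positive semidefinite continuous linear operator, b ∈ X, γ ∈ ℝ. If f solves the fixed point equation (FP), then A = √τ·E, b = (w + √τ·c)/(1 + √τ), and γ = (β(1 + √τ)² + (√τ/2)⟨c − w, E⁻¹(c − w)⟩)/((1 + √τ)²(τ + 1)); in particular A is positive definite. -/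
open scoped RealInnerProductSpace

lemma fenchelConj_quad_aux {X : Type*} [NormedAddCommGroup X] [InnerProductSpace ℝ X]
    (A : X ≃L[ℝ] X)
    (hA_sa : ∀ x y : X, (⟪A x, y⟫ : ℝ) = ⟪x, A y⟫)
    (hA_psd : ∀ x : X, 0 ≤ (⟪A x, x⟫ : ℝ))
    (b : X) (γ : ℝ) (f : X → EReal)
    (hf_def : ∀ x : X,
      f x = (((1 : ℝ) / 2 * ⟪A x, x⟫ + ⟪b, x⟫ + γ : ℝ) : EReal)) (y : X) :
    fenchelConj f y = (((1 : ℝ) / 2 * ⟪A.symm (y - b), y - b⟫ - γ : ℝ) : EReal) := by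
  obtain ⟨z, hz⟩ : ∃ z, A.symm (y - b) = z := ⟨_, rfl⟩
  have hy : y = A z + b := by
    rw [← hz]; simp
  subst hy
  rw [hz]
  have e : A z + b - b = A z := by abel
  rw [e]
  unfold fenchelConj
  apply le_antisymm
  · refine iSup_le fun x => ?_
    rw [hf_def, ← EReal.coe_sub, EReal.coe_le_coe_iff]
    have h := hA_psd (z - x)
    have h1 := hA_sa z x
    have h2 := real_inner_comm (A x) z
    have h3 := real_inner_comm (A z) z
    simp only [map_sub, inner_sub_left, inner_sub_right, inner_add_left] at *
    linarith
  · refine le_iSup_of_le z ?_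
    rw [hf_def, ← EReal.coe_sub, EReal.coe_le_coe_iff]
    have h3 := real_inner_comm (A z) z
    simp only [inner_add_left] at *
    linarith

/-- if `E` is positive definite and the quadratic function
`f(x) = (1/2)⟪Ax,x⟫ + ⟪b,x⟫ + γ` (with `A` invertible positive semidefinite) solves (FP),
then `A = √τ·E`, `b = (w + √τ·c)/(1 + √τ)` and
`γ = (β(1+√τ)² + (√τ/2)⟪c−w, E⁻¹(c−w)⟫)/((1+√τ)²(τ+1))`; in particular `A` is positive
definite. -/
theorem quadratic_solution_coefficients_positive_definite_case
    {X : Type*} [NormedAddCommGroup X] [InnerProductSpace ℝ X] [CompleteSpace X] [Nontrivial X]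
    (τ : ℝ) (hτ : 0 < τ) (c w : X) (β : ℝ) (E : X ≃L[ℝ] X)
    (hE_sa : ∀ x y : X, (⟪E x, y⟫ : ℝ) = ⟪x, E y⟫)
    (hE_pd : ∀ x : X, x ≠ 0 → 0 < (⟪E x, x⟫ : ℝ))
    (A : X ≃L[ℝ] X)
    (hA_sa : ∀ x y : X, (⟪A x, y⟫ : ℝ) = ⟪x, A y⟫)
    (hA_psd : ∀ x : X, 0 ≤ (⟪A x, x⟫ : ℝ))
    (b : X) (γ : ℝ) (f : X → EReal)
    (hf_def : ∀ x : X,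
      f x = (((1 : ℝ) / 2 * ⟪A x, x⟫ + ⟪b, x⟫ + γ : ℝ) : EReal))
    (hsol : SolvesFP τ c w β E f) :
    (∀ x : X, A x = Real.sqrt τ • E x) ∧
      b = (1 + Real.sqrt τ)⁻¹ • (w + Real.sqrt τ • c) ∧
      γ = (β * (1 + Real.sqrt τ) ^ 2
            + Real.sqrt τ / 2 * ⟪c - w, E.symm (c - w)⟫)
          / ((1 + Real.sqrt τ) ^ 2 * (τ + 1)) ∧
      (∀ x : X, x ≠ 0 → 0 < (⟪A x, x⟫ : ℝ)) := by
  have key : ∀ x : X, (1 : ℝ) / 2 * ⟪A x, x⟫ + ⟪b, x⟫ + γ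
      = τ * ((1 : ℝ) / 2 * ⟪A.symm (E x + (c - b)), E x + (c - b)⟫ - γ) + ⟪w, x⟫ + β := by
    intro x
    have h := hsol x
    rw [fenchelConj_quad_aux A hA_sa hA_psd b γ f hf_def, hf_def, ← EReal.coe_mul,
      ← EReal.coe_add, ← EReal.coe_add, EReal.coe_eq_coe_iff, add_sub_assoc] at h
    exact h
  have hB : ∀ x y : X, (⟪A.symm x, y⟫ : ℝ) = ⟪x, A.symm y⟫ := by
    intro x y
    have h := hA_sa (A.symm x) (A.symm y)
    simp only [ContinuousLinearEquiv.apply_symm_apply] at h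
    exact h.symm
  obtain ⟨d, hd⟩ : ∃ d, c - b = d := ⟨_, rfl⟩
  rw [hd] at key
  have exp1 : ∀ x : X, (⟪A.symm (E x + d), E x + d⟫ : ℝ)
      = ⟪A.symm (E x), E x⟫ + 2 * ⟪E (A.symm d), x⟫ + ⟪A.symm d, d⟫ := by
    intro x
    have h1 := hB (E x) d
    have h2 := real_inner_comm (E x) (A.symm d)
    have h3 := hE_sa (A.symm d) x
    simp only [map_add, inner_add_left, inner_add_right]
    linarith
  have hC : γ = τ * ((1 : ℝ) / 2 * ⟪A.symm d, d⟫ - γ) + β := by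
    have h := key 0
    simpa using h
  have hQ : ∀ x : X, (⟪A x, x⟫ : ℝ) = τ * ⟪A.symm (E x), E x⟫ := by
    intro x
    have h1 := key x
    have h2 := key (-x)
    rw [exp1] at h1 h2
    simp only [map_neg, inner_neg_left, inner_neg_right, neg_neg] at h2
    linarith
  have hL : ∀ x : X, (⟪b, x⟫ : ℝ) = τ * ⟪E (A.symm d), x⟫ + ⟪w, x⟫ := by
    intro x
    have h1 := key x
    have h2 := hQ x
    rw [exp1] at h1
    linarith
  have hAE : ∀ x : X, A x = τ • E (A.symm (E x)) := by
    intro x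
    refine ext_inner_right ℝ fun y => ?_
    have h1 := hQ x
    have h2 := hQ y
    have h3 := hQ (x + y)
    have h4 := hA_sa x y
    have h5 := real_inner_comm (A y) x
    have h6 := hB (E x) (E y)
    have h7 := real_inner_comm (A.symm (E y)) (E x)
    have h8 := hE_sa (A.symm (E x)) y
    have h9 : (⟪A.symm (E x), E y⟫ : ℝ) = ⟪A.symm (E y), E x⟫ := by linarith
    simp only [map_add, inner_add_left, inner_add_right] at h3
    rw [h9] at h3
    rw [inner_smul_left, h8, h9]
    simp only [conj_trivial]
    linarith
  have hs : 0 < Real.sqrt τ := Real.sqrt_pos.mpr hτ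
  have hss : Real.sqrt τ * Real.sqrt τ = τ := Real.mul_self_sqrt hτ.le
  obtain ⟨s, hsd⟩ : ∃ s, Real.sqrt τ = s := ⟨_, rfl⟩
  rw [hsd] at hs hss ⊢
  -- `A = s E`
  have hA : ∀ x : X, A x = s • E x := by
    intro x
    -- `v = E⁻¹ A x - s x`
    obtain ⟨v, hv⟩ : ∃ v, E.symm (A x) - s • x = v := ⟨_, rfl⟩
    have h1 : A (E.symm (A x)) = τ • E x := by
      rw [hAE (E.symm (A x))]; simp
    have h2 : A v + s • E v = 0 := by
      rw [← hv]
      simp only [map_sub, map_smul, h1, ContinuousLinearEquiv.apply_symm_apply, smul_sub,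
        smul_smul, hss]
      abel
    have hv0 : v = 0 := by
      by_contra hne
      have h3 : (⟪A v + s • E v, v⟫ : ℝ) = 0 := by rw [h2, inner_zero_left]
      rw [inner_add_left, inner_smul_left] at h3
      simp only [conj_trivial] at h3
      have h4 := hA_psd v
      have h5 := mul_pos hs (hE_pd v hne)
      linarith
    have h6 : E.symm (A x) = s • x := by
      rw [hv0] at hv; exact sub_eq_zero.mp hv
    have h7 := congrArg E h6
    simpa using h7
  have hBs : ∀ x : X, A.symm x = s⁻¹ • E.symm x := by
    intro x
    apply A.injective
    rw [hA (s⁻¹ • E.symm x)]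
    simp [smul_smul, hs.ne']
  have h1s : (1 + s) ≠ 0 := by positivity
  have hb0 : b = s • d + w := by
    refine ext_inner_right ℝ fun y => ?_
    rw [hL y, hBs, map_smul, ContinuousLinearEquiv.apply_symm_apply, inner_add_left,
      inner_smul_left, inner_smul_left]
    simp only [conj_trivial]
    rw [← hss]
    field_simp
  have hb1 : (1 + s) • b = w + s • c := by
    have : (1 + s) • b = b + s • b := by rw [add_smul, one_smul]
    rw [this]
    nth_rewrite 1 [hb0]
    rw [← hd, smul_sub]; abel
  have hb : b = (1 + s)⁻¹ • (w + s • c) := by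
    rw [← hb1, smul_smul, inv_mul_cancel₀ h1s, one_smul]
  have hd1 : d = (1 + s)⁻¹ • (c - w) := by
    have : (1 + s) • d = c - w := by
      rw [← hd, smul_sub, hb1, add_smul, one_smul]; abel
    rw [← this, smul_smul, inv_mul_cancel₀ h1s, one_smul]
  refine ⟨hA, hb, ?_, ?_⟩
  · have h1 : (⟪A.symm d, d⟫ : ℝ)
        = s⁻¹ * ((1 + s)⁻¹ * ((1 + s)⁻¹ * ⟪c - w, E.symm (c - w)⟫)) := by
      rw [hBs, hd1, map_smul]
      simp only [inner_smul_left, inner_smul_right, conj_trivial]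
      rw [real_inner_comm]
      ring
    have hτ1 : τ + 1 ≠ 0 := by positivity
    rw [h1] at hC
    rw [eq_div_iff (by positivity)]
    generalize (⟪c - w, E.symm (c - w)⟫ : ℝ) = q at hC ⊢
    rw [← hss] at hC ⊢
    field_simp at hC
    linarith
  · intro x hx
    rw [hA, inner_smul_left]
    exact mul_pos hs (hE_pd x hx)
end

section
/- Suppose the invertible continuous linear operator E is positive semidefinite. If f : X → [-∞,+∞] solves the fixed point equation (FP), then there exist a positive semidefinite invertible continuous linear operator Q' : X → X, a vector q' ∈ X, and a real number θ' such that f(x) ≤ (1/2)⟨Q'x, x⟩ + ⟨q', x⟩ + θ' for all x ∈ X. -/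
open scoped RealInnerProductSpace

/-- if the invertible operator `E` is positive semidefinite, then any
solution `f` of (FP) admits a quadratic upper bound
`f(x) ≤ (1/2)⟪Q'x, x⟫ + ⟪q', x⟫ + θ'` with `Q'` positive semidefinite and invertible. -/
theorem solution_of_FP_quadratic_upper_bound
    {X : Type*} [NormedAddCommGroup X] [InnerProductSpace ℝ X] [CompleteSpace X] [Nontrivial X]
    (τ : ℝ) (hτ : 0 < τ) (c w : X) (β : ℝ) (E : X ≃L[ℝ] X)
    (hE_sa : ∀ x y : X, (⟪E x, y⟫ : ℝ) = ⟪x, E y⟫)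
    (hE_psd : ∀ x : X, 0 ≤ (⟪E x, x⟫ : ℝ))
    (f : X → EReal) (hf : SolvesFP τ c w β E f) :
    ∃ Q' : X ≃L[ℝ] X,
      (∀ x y : X, (⟪Q' x, y⟫ : ℝ) = ⟪x, Q' y⟫) ∧
      (∀ x : X, 0 ≤ (⟪Q' x, x⟫ : ℝ)) ∧
      ∃ q' : X, ∃ θ' : ℝ,
        ∀ x : X,
          f x ≤ (((1 : ℝ) / 2 * ⟪Q' x, x⟫ + ⟪q', x⟫ + θ' : ℝ) : EReal) := by
  have hbot : ∀ x, f x ≠ ⊥ := by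
    intro x hx
    have h1 : ∀ y, fenchelConj f y = ⊤ := by
      intro y
      apply top_le_iff.mp
      refine le_trans ?_ (le_iSup (fun z : X => ((⟪y, z⟫ : ℝ) : EReal) - f z) x)
      simp [hx]
    have h2 := hf x
    rw [h1, EReal.coe_mul_top_of_pos hτ, hx] at h2
    simp at h2
  have h1τ : (0:ℝ) < 1 + τ := by linarith
  have hlow : ∀ x, (((τ * ⟪E x, x⟫ + τ * ⟪c, x⟫ + ⟪w, x⟫ + β) / (1 + τ) : ℝ) : EReal) ≤ f x := by
    intro x
    by_cases ht : f x = ⊤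
    · rw [ht]; exact le_top
    obtain ⟨r, hr⟩ : ∃ r : ℝ, f x = r := ⟨(f x).toReal, (EReal.coe_toReal ht (hbot x)).symm⟩
    have h2 := hf x
    have h3 : ((⟪E x + c, x⟫ - r : ℝ) : EReal) ≤ fenchelConj f (E x + c) := by
      have := le_iSup (fun z : X => ((⟪E x + c, z⟫ : ℝ) : EReal) - f z) x
      simp only [hr] at this
      exact_mod_cast this
    have h4 : ((τ * (⟪E x + c, x⟫ - r) + ⟪w, x⟫ + β : ℝ) : EReal) ≤ f x := by
      rw [h2]
      push_cast [EReal.coe_add, EReal.coe_mul]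
      have h5 := mul_le_mul_of_nonneg_left h3 (EReal.coe_nonneg.mpr hτ.le)
      push_cast at h5
      gcongr
    rw [hr] at h4 ⊢
    have h6 := EReal.coe_le_coe_iff.mp h4
    rw [inner_add_left] at h6
    rw [EReal.coe_le_coe_iff, div_le_iff₀ h1τ]
    linarith
  obtain ⟨d, hd⟩ := E.surjective ((1 / (1 + τ)) • (c - w))
  set k : ℝ := (1 + τ) / (2 * τ) with hk
  have hconj : ∀ x, fenchelConj f (E x + c) ≤
      (((1 + τ) / (4 * τ) * ⟪E (x + d), x + d⟫ - β / (1 + τ) : ℝ) : EReal) := by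
    intro x
    refine iSup_le fun z => ?_
    have hz : ((⟪E x + c, z⟫ : ℝ) : EReal) - f z ≤ ((⟪E x + c, z⟫ : ℝ) : EReal) -
        (((τ * ⟪E z, z⟫ + τ * ⟪c, z⟫ + ⟪w, z⟫ + β) / (1 + τ) : ℝ) : EReal) :=
      EReal.sub_le_sub le_rfl (hlow z)
    refine hz.trans ?_
    rw [← EReal.coe_sub, EReal.coe_le_coe_iff]
    have hp := hE_psd (z - k • (x + d))
    have hs : (⟪E z, x + d⟫ : ℝ) = ⟪E (x + d), z⟫ := by
      rw [hE_sa, real_inner_comm]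
    have hdz : (⟪E (x + d), z⟫ : ℝ) = ⟪E x, z⟫ + (1 / (1 + τ)) * (⟪c, z⟫ - ⟪w, z⟫) := by
      rw [map_add, hd, inner_add_left, real_inner_smul_left, inner_sub_left]
    rw [map_sub, map_smul, inner_sub_left, inner_sub_right, inner_sub_right,
      real_inner_smul_left, real_inner_smul_left, real_inner_smul_right, real_inner_smul_right,
      hs, hdz] at hp
    rw [inner_add_left]
    have hp2 := mul_nonneg (div_pos hτ h1τ).le hp
    rw [← sub_nonneg]
    refine hp2.trans_eq ?_
    rw [hk]
    field_simp
    ring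
  have hk' : (1 + τ) / 2 ≠ 0 := by positivity
  let Q : X ≃L[ℝ] X := E.trans (ContinuousLinearEquiv.smulLeft (Units.mk0 ((1 + τ) / 2) hk'))
  have hQ : ∀ x, Q x = ((1 + τ) / 2) • E x := fun x => rfl
  refine ⟨Q, ?_, ?_, ((1 + τ) / 2) • E d + w,
    (1 + τ) / 4 * ⟪E d, d⟫ - τ * (β / (1 + τ)) + β, ?_⟩
  · intro x y
    rw [hQ, hQ, real_inner_smul_left, real_inner_smul_right, hE_sa]
  · intro x
    rw [hQ, real_inner_smul_left]
    exact mul_nonneg (by positivity) (hE_psd x)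
  · intro x
    have h5 := mul_le_mul_of_nonneg_left (hconj x) (EReal.coe_nonneg.mpr hτ.le)
    rw [← EReal.coe_mul] at h5
    have h6 : f x ≤ ((τ * ((1 + τ) / (4 * τ) * ⟪E (x + d), x + d⟫ - β / (1 + τ)) + ⟪w, x⟫ + β : ℝ)
        : EReal) := by
      rw [hf x, EReal.coe_add, EReal.coe_add]
      gcongr
    refine h6.trans (le_of_eq ?_)
    congr 1
    have hs : (⟪E x, d⟫ : ℝ) = ⟪E d, x⟫ := by
      rw [hE_sa, real_inner_comm]
    rw [hQ, map_add, inner_add_left, inner_add_left, inner_add_right, inner_add_right,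
      real_inner_smul_left, real_inner_smul_left, hs]
    field_simp
    ring
end

section
/- Suppose the invertible continuous linear operator E is positive semidefinite. Then any solution f : X → [-∞,+∞] of the fixed point equation (FP) is finite everywhere (i.e., f(x) ∈ ℝ for all x ∈ X) and, viewed as a real-valued function, is locally Lipschitz continuous on X. -/
open scoped RealInnerProductSpace

theorem fp_coercive_aux
    {X : Type*} [NormedAddCommGroup X] [InnerProductSpace ℝ X]
    (E : X ≃L[ℝ] X)
    (hE_sa : ∀ x y : X, (⟪E x, y⟫ : ℝ) = ⟪x, E y⟫)
    (hE_psd : ∀ x : X, 0 ≤ (⟪E x, x⟫ : ℝ)) :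
    ∃ δ : ℝ, 0 < δ ∧ ∀ x : X, δ * ‖x‖ ^ 2 ≤ (⟪E x, x⟫ : ℝ) := by
  set M : ℝ := ‖(E : X →L[ℝ] X)‖ + 1 with hM
  have hMpos : 0 < M := by positivity
  set N : ℝ := ‖(E.symm : X →L[ℝ] X)‖ + 1 with hN
  have hNpos : 0 < N := by positivity
  refine ⟨1 / (M * N ^ 2), by positivity, fun x => ?_⟩
  have h1 : (⟪E (E x), E x⟫ : ℝ) ≤ M * ‖E x‖ ^ 2 := by
    have a1 := real_inner_le_norm (E (E x)) (E x)
    have a2 : ‖E (E x)‖ ≤ ‖(E : X →L[ℝ] X)‖ * ‖E x‖ := (E : X →L[ℝ] X).le_opNorm (E x)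
    nlinarith [norm_nonneg (E x)]
  have h2 : ‖x‖ ≤ N * ‖E x‖ := by
    have a2 : ‖E.symm (E x)‖ ≤ ‖(E.symm : X →L[ℝ] X)‖ * ‖E x‖ :=
      (E.symm : X →L[ℝ] X).le_opNorm (E x)
    rw [E.symm_apply_apply] at a2
    nlinarith [norm_nonneg (E x)]
  have h3 := hE_psd (M • x - E x)
  have h4 : (⟪E (M • x - E x), M • x - E x⟫ : ℝ)
      = M ^ 2 * ⟪E x, x⟫ - 2 * M * ‖E x‖ ^ 2 + ⟪E (E x), E x⟫ := by
    have e1 : (⟪E (E x), x⟫ : ℝ) = ‖E x‖ ^ 2 := by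
      rw [hE_sa, real_inner_self_eq_norm_sq]
    simp only [map_sub, map_smul, inner_sub_left, inner_sub_right, real_inner_smul_left,
      real_inner_smul_right, e1, real_inner_self_eq_norm_sq]
    ring
  have h5 : ‖E x‖ ^ 2 ≤ M * ⟪E x, x⟫ := by
    have : M * ‖E x‖ ^ 2 ≤ M * (M * ⟪E x, x⟫) := by nlinarith
    exact le_of_mul_le_mul_left this hMpos
  have h6 : ‖x‖ ^ 2 ≤ N ^ 2 * ‖E x‖ ^ 2 := by
    rw [← mul_pow]; exact pow_le_pow_left₀ (norm_nonneg _) h2 2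
  rw [one_div, inv_mul_le_iff₀ (by positivity)]
  nlinarith [sq_nonneg N, mul_le_mul_of_nonneg_left h5 (sq_nonneg N)]

/-- if the invertible operator `E` is positive semidefinite, then any
solution of (FP) is finite everywhere and, viewed as a real-valued function, locally
Lipschitz continuous. -/
theorem solution_of_FP_finite_and_locally_Lipschitz
    {X : Type*} [NormedAddCommGroup X] [InnerProductSpace ℝ X] [CompleteSpace X] [Nontrivial X]
    (τ : ℝ) (hτ : 0 < τ) (c w : X) (β : ℝ) (E : X ≃L[ℝ] X)
    (hE_sa : ∀ x y : X, (⟪E x, y⟫ : ℝ) = ⟪x, E y⟫)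
    (hE_psd : ∀ x : X, 0 ≤ (⟪E x, x⟫ : ℝ))
    (f : X → EReal) (hf : SolvesFP τ c w β E f) :
    ∃ g : X → ℝ, (∀ x : X, f x = ((g x : ℝ) : EReal)) ∧ LocallyLipschitz g := by
  obtain ⟨δ, hδ, hco⟩ := fp_coercive_aux E hE_sa hE_psd
  have hle : ∀ y x, ((⟪y, x⟫ : ℝ) : EReal) - f x ≤ fenchelConj f y := fun y x =>
    le_iSup (fun x : X => ((⟪y, x⟫ : ℝ) : EReal) - f x) x
  -- f is nowhere ⊥
  have hnb : ∀ x, f x ≠ ⊥ := by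
    intro x hx
    have htop : ∀ y, fenchelConj f y = ⊤ := by
      intro y
      have := hle y x
      rw [hx] at this
      simpa using this
    have h := hf x
    rw [htop, hx, EReal.coe_mul_top_of_pos hτ] at h
    simp at h
  -- f is somewhere finite
  have hex : ∃ x, f x ≠ ⊤ := by
    by_contra! hall
    have hbot : ∀ y, fenchelConj f y = ⊥ := by
      intro y
      simp [fenchelConj, hall]
    have h := hf 0
    rw [hbot, hall, EReal.coe_mul_bot_of_pos hτ] at h
    simp at h
  have hcnb : ∀ y, fenchelConj f y ≠ ⊥ := by
    intro y hy
    obtain ⟨x, hx⟩ := hex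
    have h := hle y x
    rw [hy, ← EReal.coe_toReal hx (hnb x), ← EReal.coe_sub] at h
    exact EReal.coe_ne_bot _ (le_bot_iff.mp h)
  set B : ℝ := ‖τ • c + w‖ with hB
  -- quadratic lower bound
  have hlow : ∀ x (r : ℝ), f x = r → τ * δ * ‖x‖ ^ 2 - B * ‖x‖ + β ≤ (1 + τ) * r := by
    intro x r hr
    have h := hf x
    have h2 := hle (E x + c) x
    have h3 := hcnb (E x + c)
    generalize fenchelConj f (E x + c) = s at h h2 h3
    induction s with
    | bot => exact absurd rfl h3
    | top => rw [EReal.coe_mul_top_of_pos hτ, hr] at h; simp at h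
    | coe s =>
      rw [hr] at h h2
      norm_cast at h h2
      have h4 := real_inner_le_norm (-(τ • c + w)) x
      rw [norm_neg, ← hB, inner_neg_left, inner_add_left, real_inner_smul_left] at h4
      rw [inner_add_left] at h2
      have h5 := hco x
      have h6 := mul_le_mul_of_nonneg_left h2 hτ.le
      have h7 := mul_le_mul_of_nonneg_left h5 hτ.le
      nlinarith
  set H : X → ℝ := fun y => ((((1 + τ) * ‖y‖ + B) ^ 2) / (4 * (τ * δ)) - β) / (1 + τ) with hH
  have hup : ∀ y, fenchelConj f y ≤ (H y : EReal) := by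
    intro y
    refine iSup_le fun x => ?_
    by_cases hx : f x = ⊤
    · rw [hx]; simp
    · have hr := (EReal.coe_toReal hx (hnb x)).symm
      have hl := hlow x _ hr
      rw [hr]
      norm_cast
      rw [hH]
      simp only
      rw [le_div_iff₀ (by positivity)]
      have hin := real_inner_le_norm y x
      have hq : ((1 + τ) * ‖y‖ + B) * ‖x‖ - τ * δ * ‖x‖ ^ 2
          ≤ (((1 + τ) * ‖y‖ + B) ^ 2) / (4 * (τ * δ)) := by
        rw [le_div_iff₀ (by positivity)]
        nlinarith [sq_nonneg (((1 + τ) * ‖y‖ + B) - 2 * (τ * δ) * ‖x‖)]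
      nlinarith [mul_le_mul_of_nonneg_left hin (by positivity : 0 ≤ 1 + τ)]
  set h : X → ℝ := fun y => (fenchelConj f y).toReal with hh
  have hch : ∀ y, fenchelConj f y = (h y : EReal) := by
    intro y
    refine (EReal.coe_toReal (fun ht => ?_) (hcnb y)).symm
    have := hup y
    rw [ht] at this
    simp at this
  set g : X → ℝ := fun x => τ * h (E x + c) + ⟪w, x⟫ + β with hg
  have hfg : ∀ x, f x = (g x : EReal) := by
    intro x
    rw [hf x, hch]
    norm_cast
  refine ⟨g, hfg, ?_⟩
  have hFY : ∀ y x, (⟪y, x⟫ : ℝ) - g x ≤ h y := by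
    intro y x
    have := hle y x
    rw [hch, hfg] at this
    exact_mod_cast this
  have hlub : ∀ y (m : ℝ), (∀ x, (⟪y, x⟫ : ℝ) - g x ≤ m) → h y ≤ m := by
    intro y m hm
    have : fenchelConj f y ≤ (m : EReal) := by
      refine iSup_le fun x => ?_
      rw [hfg]
      exact_mod_cast hm x
    rw [hch] at this
    exact_mod_cast this
  have hHle : ∀ y, h y ≤ H y := by
    intro y
    have := hup y
    rw [hch] at this
    exact_mod_cast this
  have hconv : ConvexOn ℝ Set.univ g := by
    refine ⟨convex_univ, fun x _ y _ a b ha hb hab => ?_⟩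
    have key : h (E (a • x + b • y) + c) ≤ a * h (E x + c) + b * h (E y + c) := by
      apply hlub
      intro z
      have e : (⟪E (a • x + b • y) + c, z⟫ : ℝ) = a * ⟪E x + c, z⟫ + b * ⟪E y + c, z⟫ := by
        simp only [map_add, map_smul, inner_add_left, real_inner_smul_left]
        linear_combination (-(⟪c, z⟫ : ℝ)) * hab
      rw [e]
      have h1 := mul_le_mul_of_nonneg_left (hFY (E x + c) z) ha
      have h2 := mul_le_mul_of_nonneg_left (hFY (E y + c) z) hb
      have h3 : g z = a * g z + b * g z := by rw [← add_mul, hab, one_mul]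
      linarith
    have hk := mul_le_mul_of_nonneg_left key hτ.le
    have h3 : β = a * β + b * β := by rw [← add_mul, hab, one_mul]
    simp only [hg, smul_eq_mul, inner_add_right, real_inner_smul_right]
    linarith
  rw [← locallyLipschitzOn_univ]
  have htf : (∃ x₀ ∈ (Set.univ : Set X), (nhds x₀).IsBoundedUnder (· ≤ ·) g) ↔
      LocallyLipschitzOn Set.univ g :=
    (hconv.continuousOn_tfae isOpen_univ Set.univ_nonempty).out 3 0
  refine htf.mp ⟨0, Set.mem_univ _, ?_⟩
  have hcont : Continuous fun x => τ * H (E x + c) + (⟪w, x⟫ : ℝ) + β := by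
    simp only [hH]
    fun_prop
  refine (hcont.tendsto 0).isBoundedUnder_le.mono_le (Filter.Eventually.of_forall fun x => ?_)
  have := mul_le_mul_of_nonneg_left (hHle (E x + c)) hτ.le
  simp only [hg]
  linarith
end

section
/- Suppose the invertible continuous linear operator E is positive semidefinite. Then any solution f : X → ℝ of the fixed point equation (FP) that is at most quadratic must be strictly convex; in particular f is quadratic and its leading coefficient is positive definite. -/
open scoped RealInnerProductSpace

theorem aux_quad (k p q : ℝ) (h : ∀ t : ℝ, k * t ^ 2 + p * t + q ≤ 0) : k ≤ 0 := by
  by_contra! hk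
  have h1 := h (|q| / k + 1)
  have h2 := h (-(|q| / k + 1))
  have h3 : k * (|q| / k) = |q| := by field_simp
  have h4 : 0 ≤ |q| / k := by positivity
  have h5 := neg_abs_le q
  nlinarith [mul_nonneg hk.le (mul_nonneg h4 h4), abs_nonneg q]

theorem aux_lin (p q : ℝ) (h : ∀ t : ℝ, p * t + q ≤ 0) : p = 0 := by
  by_contra hp
  have h1 := h ((1 - q) / p)
  rw [mul_div_cancel₀ _ hp] at h1
  linarith

theorem aux_ineq {X : Type*} [NormedAddCommGroup X] [InnerProductSpace ℝ X]
    (τ : ℝ) (hτ : 0 < τ) (c w : X) (β : ℝ) (E : X ≃L[ℝ] X) (f : X → ℝ)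
    (hsol : SolvesFP τ c w β E (fun x => ((f x : ℝ) : EReal))) (x y : X) :
    τ * (⟪E x + c, y⟫ - f y) + ⟪w, x⟫ + β ≤ f x := by
  have h := hsol x
  have h1 : ((⟪E x + c, y⟫ - f y : ℝ) : EReal)
      ≤ fenchelConj (fun x => ((f x : ℝ) : EReal)) (E x + c) := by
    rw [EReal.coe_sub]
    exact le_iSup (fun y : X => ((⟪E x + c, y⟫ : ℝ) : EReal) - ((f y : ℝ) : EReal)) y
  have h2 : (τ : EReal) * ((⟪E x + c, y⟫ - f y : ℝ) : EReal)
      ≤ (τ : EReal) * fenchelConj (fun x => ((f x : ℝ) : EReal)) (E x + c) :=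
    mul_le_mul_of_nonneg_left h1 (by exact_mod_cast hτ.le)
  have h3 := add_le_add_left (add_le_add_left h2 ((⟪w, x⟫ : ℝ) : EReal)) (β : EReal)
  rw [← EReal.coe_mul, ← EReal.coe_add, ← EReal.coe_add] at h3
  have h4 := h3.trans_eq h.symm
  exact EReal.coe_le_coe_iff.1 h4

theorem aux_pos {X : Type*} [NormedAddCommGroup X] [InnerProductSpace ℝ X]
    (τ : ℝ) (hτ : 0 < τ) (c w : X) (β : ℝ) (E : X ≃L[ℝ] X) (f : X → ℝ)
    (hsol : SolvesFP τ c w β E (fun x => ((f x : ℝ) : EReal)))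
    (A : X →L[ℝ] X) (b : X) (γ : ℝ)
    (hf : ∀ x : X, f x = (1 : ℝ) / 2 * ⟪A x, x⟫ + ⟪b, x⟫ + γ) (x : X) (hx : x ≠ 0) :
    0 < (⟪A x, x⟫ : ℝ) := by
  have key := aux_ineq τ hτ c w β E f hsol
  have h0 : 0 ≤ (⟪A x, x⟫ : ℝ) := by
    have := aux_quad (-(τ * (1 / 2 * ⟪A x, x⟫))) (τ * (⟪c, x⟫ - ⟪b, x⟫)) (-(τ * γ) + β - γ) (by
      intro t
      have h := key 0 (t • x)
      simp only [hf, map_zero, map_smul, inner_smul_left, inner_smul_right, inner_zero_right,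
        inner_zero_left, zero_add, conj_trivial] at h
      linarith)
    nlinarith
  refine lt_of_le_of_ne h0 fun h00 => hx ?_
  have sl : ∀ s : ℝ, τ * s * ⟪E x, E x⟫ + ⟪w, x⟫ - ⟪b, x⟫ = 0 := by
    intro s
    refine aux_lin _ (τ * (⟪c, s • E x⟫ - f (s • E x)) + β - γ) fun t => ?_
    have h := key (t • x) (s • E x)
    rw [hf (t • x)] at h
    simp only [map_smul, inner_add_left, inner_smul_left, inner_smul_right,
        conj_trivial, ← h00] at h ⊢
    linarith
  have s0 := sl 0
  have s1 := sl 1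
  have h1 : τ * ⟪E x, E x⟫ = 0 := by linarith
  have h2 : E x = 0 := inner_self_eq_zero.1 ((mul_eq_zero.1 h1).resolve_left hτ.ne')
  simpa using h2

/-- if `E` is positive semidefinite (and invertible), then any at most
quadratic real-valued solution of (FP) is strictly convex; in particular it is quadratic
with a positive definite leading coefficient. -/
theorem at_most_quadratic_solution_is_strictly_convex
    {X : Type*} [NormedAddCommGroup X] [InnerProductSpace ℝ X] [CompleteSpace X] [Nontrivial X]
    (τ : ℝ) (hτ : 0 < τ) (c w : X) (β : ℝ) (E : X ≃L[ℝ] X)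
    (hE_sa : ∀ x y : X, (⟪E x, y⟫ : ℝ) = ⟪x, E y⟫)
    (hE_psd : ∀ x : X, 0 ≤ (⟪E x, x⟫ : ℝ))
    (f : X → ℝ)
    (hquad : ∃ A : X →L[ℝ] X, (∀ x y : X, (⟪A x, y⟫ : ℝ) = ⟪x, A y⟫) ∧
      ∃ b : X, ∃ γ : ℝ,
        ∀ x : X, f x = (1 : ℝ) / 2 * ⟪A x, x⟫ + ⟪b, x⟫ + γ)
    (hsol : SolvesFP τ c w β E (fun x => ((f x : ℝ) : EReal))) :
    StrictConvexOn ℝ Set.univ f ∧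
      ∀ A : X →L[ℝ] X, (∀ x y : X, (⟪A x, y⟫ : ℝ) = ⟪x, A y⟫) →
        ∀ b : X, ∀ γ : ℝ,
          (∀ x : X, f x = (1 : ℝ) / 2 * ⟪A x, x⟫ + ⟪b, x⟫ + γ) →
          A ≠ 0 ∧ (∀ x : X, x ≠ 0 → 0 < (⟪A x, x⟫ : ℝ)) := by
  have pos := fun A b γ hf => aux_pos τ hτ c w β E f hsol A b γ hf
  refine ⟨?_, fun A _ b γ hf => ⟨?_, pos A b γ hf⟩⟩
  · obtain ⟨A, hA, b, γ, hf⟩ := hquad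
    refine ⟨convex_univ, fun x _ y _ hxy s t hs ht hst => ?_⟩
    have hp := pos A b γ hf (x - y) (sub_ne_zero.2 hxy)
    have hp2 := mul_pos (mul_pos hs ht) hp
    have hyx : (⟪A y, x⟫ : ℝ) = ⟪A x, y⟫ := by rw [hA, real_inner_comm]
    simp only [hf, map_add, map_sub, map_smul, inner_add_left, inner_add_right, inner_sub_left,
      inner_sub_right, inner_smul_left, inner_smul_right, conj_trivial, smul_eq_mul, hyx] at hp2 ⊢
    obtain rfl : t = 1 - s := by linarith
    linarith
  · rintro rfl
    obtain ⟨x, hx⟩ := exists_ne (0 : X)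
    simpa using pos 0 b γ hf x hx
end

section
/- Suppose the invertible continuous linear operator E is positive semidefinite and that f and p both solve the fixed point equation (FP). Then both f and p are finite everywhere, the function g : X → ℝ defined by g(x) := f(x) − p(x) is continuous, and g satisfies g(τx + E⁻¹w − E⁻¹c) = τ²·g(x) for all x ∈ X. -/
open scoped RealInnerProductSpace

section helpers

variable {X : Type*} [NormedAddCommGroup X] [InnerProductSpace ℝ X]

/-- completing the square -/
lemma square_bound (E : X ≃L[ℝ] X)
    (hE_sa : ∀ x y : X, (⟪E x, y⟫ : ℝ) = ⟪x, E y⟫)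
    (hE_psd : ∀ x : X, 0 ≤ (⟪E x, x⟫ : ℝ)) (a : ℝ) (ha : 0 < a) (y x : X) :
    (⟪y, x⟫ : ℝ) - a * ⟪E x, x⟫ ≤ (1 / (4 * a)) * ⟪y, E.symm y⟫ := by
  obtain ⟨u, rfl⟩ := E.surjective y
  have h := hE_psd ((2 * a) • x - u)
  simp only [map_sub, map_smul, inner_sub_left, inner_sub_right, inner_smul_left,
    inner_smul_right, ContinuousLinearEquiv.symm_apply_apply, RCLike.conj_to_real] at h ⊢
  have h2 : (⟪E x, u⟫ : ℝ) = ⟪E u, x⟫ := by rw [hE_sa, real_inner_comm]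
  rw [h2] at h
  rw [div_mul_eq_mul_div, le_div_iff₀ (by positivity)]
  nlinarith

lemma bound_below (τ : ℝ) (hτ : 0 < τ) (e k l r s β : ℝ)
    (h1 : r = τ * s + l + β) (h2 : e + k - r ≤ s) :
    (τ / (1 + τ)) * e + (τ / (1 + τ)) * k + (1 / (1 + τ)) * l + β / (1 + τ) ≤ r := by
  have : (τ / (1 + τ)) * e + (τ / (1 + τ)) * k + (1 / (1 + τ)) * l + β / (1 + τ)
    = (τ * e + τ * k + l + β) / (1 + τ) := by field_simp
  rw [this, div_le_iff₀ (by positivity)]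
  nlinarith

lemma real_of_solves (τ : ℝ) (hτ : 0 < τ) (c w : X) (β : ℝ) (E : X ≃L[ℝ] X)
    (hE_sa : ∀ x y : X, (⟪E x, y⟫ : ℝ) = ⟪x, E y⟫)
    (hE_psd : ∀ x : X, 0 ≤ (⟪E x, x⟫ : ℝ))
    (f : X → EReal) (hf : SolvesFP τ c w β E f) :
    ∃ F G K : X → ℝ, (∀ x, f x = (F x : EReal)) ∧ Continuous K ∧ (∀ y, G y ≤ K y) ∧
      (∀ y x, (⟪y, x⟫ : ℝ) - F x ≤ G y) ∧
      (∀ y (M : ℝ), (∀ x, (⟪y, x⟫ : ℝ) - F x ≤ M) → G y ≤ M) ∧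
      (∀ x, F x = τ * G (E x + c) + ⟪w, x⟫ + β) := by
  have hle : ∀ y x, ((⟪y, x⟫ : ℝ) : EReal) - f x ≤ fenchelConj f y := fun y x =>
    le_iSup (fun x : X => ((⟪y, x⟫ : ℝ) : EReal) - f x) x
  have htop : ∀ x, fenchelConj f (E x + c) = ⊤ → f x = ⊤ := by
    intro x h
    rw [hf x, h, EReal.coe_mul_top_of_pos hτ, EReal.top_add_coe, EReal.top_add_coe]
  have hbot : ∀ x, f x ≠ ⊥ := by
    intro x hx
    have h1 := hle (E x + c) x
    rw [hx, EReal.coe_sub_bot, top_le_iff] at h1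
    have := htop x h1
    rw [hx] at this
    exact absurd this (by simp)
  have hne : ∃ x, f x ≠ ⊤ := by
    by_contra! h
    have h1 : fenchelConj f (E 0 + c) = ⊥ := by
      simp [fenchelConj, h]
    apply hbot 0
    rw [hf 0, h1, EReal.coe_mul_bot_of_pos hτ, EReal.bot_add, EReal.bot_add]
  obtain ⟨x0, hx0⟩ := hne
  have hCbot : ∀ y, fenchelConj f y ≠ ⊥ := by
    intro y hy
    have h1 := hle y x0
    lift f x0 to ℝ using ⟨hx0, hbot x0⟩ with r
    rw [hy, ← EReal.coe_sub, le_bot_iff] at h1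
    exact EReal.coe_ne_bot _ h1
  have hlow : ∀ x, (((τ / (1 + τ)) * ⟪E x, x⟫ + (τ / (1 + τ)) * ⟪c, x⟫ +
      (1 / (1 + τ)) * ⟪w, x⟫ + β / (1 + τ) : ℝ) : EReal) ≤ f x := by
    intro x
    by_cases hx : f x = ⊤
    · rw [hx]; exact le_top
    have hC : fenchelConj f (E x + c) ≠ ⊤ := fun h => hx (htop x h)
    have h1 := hle (E x + c) x
    have h2 := hf x
    lift f x to ℝ using ⟨hx, hbot x⟩ with r
    lift fenchelConj f (E x + c) to ℝ using ⟨hC, hCbot _⟩ with s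
    rw [inner_add_left] at h1
    norm_cast at h1 h2 ⊢
    exact bound_below τ hτ _ _ _ _ _ _ h2 h1
  set d : X := (τ / (1 + τ)) • c + (1 / (1 + τ)) • w with hd
  let K : X → ℝ := fun y =>
    (1 / (4 * (τ / (1 + τ)))) * ⟪y - d, E.symm (y - d)⟫ - β / (1 + τ)
  have hK : ∀ y, fenchelConj f y ≤ (K y : EReal) := by
    intro y
    refine iSup_le fun x => ?_
    have h1 := hlow x
    refine (EReal.sub_le_sub le_rfl h1).trans ?_
    norm_cast
    have h2 := square_bound E hE_sa hE_psd (τ / (1 + τ)) (by positivity) (y - d) x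
    have h3 : (⟪y - d, x⟫ : ℝ) = ⟪y, x⟫ - ((τ / (1 + τ)) * ⟪c, x⟫ + (1 / (1 + τ)) * ⟪w, x⟫) := by
      simp only [hd, inner_sub_left, inner_add_left, inner_smul_left, RCLike.conj_to_real]
    simp only [K]
    linarith
  have hCtop : ∀ y, fenchelConj f y ≠ ⊤ := fun y h => by
    have := hK y
    rw [h, top_le_iff] at this
    exact EReal.coe_ne_top _ this
  have hG : ∀ y, ∃ s : ℝ, fenchelConj f y = s := fun y =>
    ⟨_, (EReal.coe_toReal (hCtop y) (hCbot y)).symm⟩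
  choose G hG using hG
  have hF : ∀ x, f x = ((τ * G (E x + c) + ⟪w, x⟫ + β : ℝ) : EReal) := by
    intro x
    rw [hf x, hG]
    norm_cast
  refine ⟨fun x => τ * G (E x + c) + ⟪w, x⟫ + β, G, K, hF, ?_, ?_, ?_, ?_, fun _ => rfl⟩
  · simp only [K]; fun_prop
  · intro y
    have := hK y
    rw [hG] at this
    exact_mod_cast this
  · intro y x
    have := hle y x
    rw [hG, hF] at this
    exact_mod_cast this
  · intro y M hM
    have : fenchelConj f y ≤ (M : EReal) := by
      refine iSup_le fun x => ?_
      rw [hF]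
      exact_mod_cast hM x
    rw [hG] at this
    exact_mod_cast this

lemma cont_of_real (τ : ℝ) (hτ : 0 < τ) (c w : X) (β : ℝ) (E : X ≃L[ℝ] X)
    (F G K : X → ℝ) (hK : Continuous K) (hGK : ∀ y, G y ≤ K y)
    (h1 : ∀ y x, (⟪y, x⟫ : ℝ) - F x ≤ G y)
    (h2 : ∀ y (M : ℝ), (∀ x, (⟪y, x⟫ : ℝ) - F x ≤ M) → G y ≤ M)
    (h3 : ∀ x, F x = τ * G (E x + c) + ⟪w, x⟫ + β) : Continuous F := by
  have hconv : ConvexOn ℝ Set.univ G := by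
    refine ⟨convex_univ, fun x _ y _ a b ha hb hab => h2 _ _ fun z => ?_⟩
    have e1 := mul_le_mul_of_nonneg_left (h1 x z) ha
    have e2 := mul_le_mul_of_nonneg_left (h1 y z) hb
    simp only [inner_add_left, inner_smul_left, RCLike.conj_to_real, smul_eq_mul]
    have : F z = a * F z + b * F z := by rw [← add_mul, hab, one_mul]
    linarith
  have hG : Continuous G := by
    rw [← continuousOn_univ]
    refine ((hconv.continuousOn_tfae isOpen_univ Set.univ_nonempty).out 3 1).1 ?_
    refine ⟨0, Set.mem_univ _, ?_⟩
    refine Filter.IsBoundedUnder.mono_le (hK.continuousAt.isBoundedUnder_le) ?_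
    exact Filter.Eventually.of_forall hGK
  rw [funext h3]
  fun_prop

lemma eqn_of_real (τ : ℝ) (hτ : 0 < τ) (c w : X) (β : ℝ) (E : X ≃L[ℝ] X)
    (hE_sa : ∀ x y : X, (⟪E x, y⟫ : ℝ) = ⟪x, E y⟫)
    (F G : X → ℝ)
    (h1 : ∀ y x, (⟪y, x⟫ : ℝ) - F x ≤ G y)
    (h2 : ∀ y (M : ℝ), (∀ x, (⟪y, x⟫ : ℝ) - F x ≤ M) → G y ≤ M)
    (h3 : ∀ x, F x = τ * G (E x + c) + ⟪w, x⟫ + β) (x : X) :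
    F (τ • x + E.symm w - E.symm c) = τ * (τ * F x - τ * ⟪x, c⟫ - β)
      + ⟪w, τ • x + E.symm w - E.symm c⟫ + β := by
  have hv : ∀ u, E (τ • u + E.symm w - E.symm c) + c = τ • E u + w := by
    intro u; simp
  have hup : ∀ x, G (τ • E x + w) ≤ τ * F x - τ * ⟪x, c⟫ - β := by
    intro x
    refine h2 _ _ fun v => ?_
    have e := mul_le_mul_of_nonneg_left (h1 (E v + c) x) hτ.le
    rw [h3 v]
    have e1 : (⟪E x, v⟫ : ℝ) = ⟪E v, x⟫ := by rw [hE_sa, real_inner_comm]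
    simp only [inner_add_left, inner_smul_left, RCLike.conj_to_real] at e ⊢
    rw [real_inner_comm c x, e1]
    linarith
  have hlo : τ * F x - τ * ⟪x, c⟫ - β ≤ G (τ • E x + w) := by
    set g := G (τ • E x + w) with hg
    have key : G (E x + c) ≤ ((g + β) / τ + ⟪x, c⟫ - ⟪w, x⟫ - β) / τ := by
      refine h2 _ _ fun u => ?_
      have e := h1 (τ • E x + w) (τ • u + E.symm w - E.symm c)
      rw [h3 (τ • u + E.symm w - E.symm c), hv] at e
      have e2 := mul_le_mul_of_nonneg_left (hup u) hτ.le
      have e3 : (⟪E x, τ • u + E.symm w - E.symm c⟫ : ℝ)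
          = τ * ⟪E x, u⟫ + ⟪w, x⟫ - ⟪x, c⟫ := by
        rw [inner_sub_right, inner_add_right, inner_smul_right, hE_sa x (E.symm w),
          hE_sa x (E.symm c)]
        simp [real_inner_comm]
      rw [inner_add_left, inner_smul_left, e3, ← hg] at e
      simp only [RCLike.conj_to_real, inner_add_left] at e ⊢
      rw [real_inner_comm u c] at *
      rw [le_div_iff₀ hτ, ← sub_nonneg]
      have : (g + β) / τ + ⟪x, c⟫ - ⟪w, x⟫ - β - (⟪E x, u⟫ + ⟪u, c⟫ - F u) * τ
        = (g + β + τ * (⟪x, c⟫ - ⟪w, x⟫ - β - (⟪E x, u⟫ + ⟪u, c⟫ - F u) * τ)) / τ := by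
        field_simp
        ring
      rw [this]
      apply div_nonneg _ hτ.le
      linarith
    have e := h3 x
    rw [le_div_iff₀ hτ] at key
    have k2 : F x - ⟪x, c⟫ ≤ (g + β) / τ := by linarith
    rw [le_div_iff₀ hτ] at k2
    linarith
  rw [h3 (τ • x + E.symm w - E.symm c), hv, le_antisymm (hup x) hlo]

end helpers

/-- if `E` is positive semidefinite (and invertible) and `f`, `p` both
solve (FP), then both are finite everywhere, and their difference `g = f - p` is a
continuous real-valued function satisfying `g(τx + E⁻¹w − E⁻¹c) = τ²·g(x)`. -/
theorem difference_of_two_solutions_functional_equation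
    {X : Type*} [NormedAddCommGroup X] [InnerProductSpace ℝ X] [CompleteSpace X] [Nontrivial X]
    (τ : ℝ) (hτ : 0 < τ) (c w : X) (β : ℝ) (E : X ≃L[ℝ] X)
    (hE_sa : ∀ x y : X, (⟪E x, y⟫ : ℝ) = ⟪x, E y⟫)
    (hE_psd : ∀ x : X, 0 ≤ (⟪E x, x⟫ : ℝ))
    (f p : X → EReal)
    (hf : SolvesFP τ c w β E f) (hp : SolvesFP τ c w β E p) :
    ∃ F P : X → ℝ,
      (∀ x : X, f x = ((F x : ℝ) : EReal)) ∧
      (∀ x : X, p x = ((P x : ℝ) : EReal)) ∧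
      Continuous (fun x => F x - P x) ∧
      (∀ x : X, F (τ • x + E.symm w - E.symm c) - P (τ • x + E.symm w - E.symm c)
        = τ ^ 2 * (F x - P x)) := by
  obtain ⟨F, G, K, hfF, hK, hGK, h1, h2, h3⟩ := real_of_solves τ hτ c w β E hE_sa hE_psd f hf
  obtain ⟨P, G', K', hpP, hK', hGK', h1', h2', h3'⟩ :=
    real_of_solves τ hτ c w β E hE_sa hE_psd p hp
  refine ⟨F, P, hfF, hpP, ?_, fun x => ?_⟩
  · exact (cont_of_real τ hτ c w β E F G K hK hGK h1 h2 h3).sub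
      (cont_of_real τ hτ c w β E P G' K' hK' hGK' h1' h2' h3')
  · rw [eqn_of_real τ hτ c w β E hE_sa F G h1 h2 h3 x,
      eqn_of_real τ hτ c w β E hE_sa P G' h1' h2' h3' x]
    ring
end

section
/- Suppose the invertible continuous linear operator E is positive definite. Then the function p : X → ℝ defined by p(x) = (1/2)⟨Ax, x⟩ + ⟨b, x⟩ + γ, where A = √τ·E, b = (w + √τ·c)/(1 + √τ), and γ = (β(1 + √τ)² + (√τ/2)⟨c − w, E⁻¹(c − w)⟩)/((1 + √τ)²(τ + 1)), solves the fixed point equation (FP) and is strictly convex. Moreover, p is the unique solution of (FP) in the class of quadratic functions whose leading coefficient is invertible. -/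
open scoped RealInnerProductSpace

/-- The quadratic function `p(x) = (1/2)⟪√τ·Ex, x⟫ + ⟪(w + √τ·c)/(1+√τ), x⟫ + γ` with
`γ = (β(1+√τ)² + (√τ/2)⟪c−w, E⁻¹(c−w)⟫)/((1+√τ)²(τ+1))`. -/
noncomputable def pFun {X : Type*} [NormedAddCommGroup X] [InnerProductSpace ℝ X]
    (τ : ℝ) (c w : X) (β : ℝ) (E : X ≃L[ℝ] X) : X → ℝ :=
  fun x => (1 : ℝ) / 2 * ⟪Real.sqrt τ • E x, x⟫
    + ⟪(1 + Real.sqrt τ)⁻¹ • (w + Real.sqrt τ • c), x⟫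
    + (β * (1 + Real.sqrt τ) ^ 2 + Real.sqrt τ / 2 * ⟪c - w, E.symm (c - w)⟫)
        / ((1 + Real.sqrt τ) ^ 2 * (τ + 1))

lemma conj_quad {X : Type*} [NormedAddCommGroup X] [InnerProductSpace ℝ X]
    (A : X →L[ℝ] X) (hs : ∀ x y : X, (⟪A x, y⟫ : ℝ) = ⟪x, A y⟫)
    (hp : ∀ x : X, 0 ≤ (⟪A x, x⟫ : ℝ)) (b : X) (γ : ℝ) (f : X → ℝ)
    (hf : ∀ x : X, f x = (1 : ℝ) / 2 * ⟪A x, x⟫ + ⟪b, x⟫ + γ)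
    (y u : X) (hu : A u = y - b) :
    fenchelConj (fun x => ((f x : ℝ) : EReal)) y
      = ((1 / 2 * ⟪A u, u⟫ - γ : ℝ) : EReal) := by
  have hy : y = A u + b := by rw [hu]; abel
  unfold fenchelConj
  apply le_antisymm
  · apply iSup_le
    intro x
    rw [← EReal.coe_sub, EReal.coe_le_coe_iff, hf]
    have h := hp (x - u)
    have h1 : (⟪A x, u⟫ : ℝ) = ⟪A u, x⟫ := by rw [hs x u, real_inner_comm]
    rw [map_sub, inner_sub_left, inner_sub_right, inner_sub_right, h1] at h
    rw [hy, inner_add_left]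
    linarith
  · refine le_trans (le_of_eq ?_)
      (le_iSup (fun x : X => ((⟪y, x⟫ : ℝ) : EReal) - ((f x : ℝ) : EReal)) u)
    rw [← EReal.coe_sub, EReal.coe_eq_coe_iff, hf, hy, inner_add_left]
    ring

lemma nonneg_of_bdd (a d M : ℝ) (h : ∀ t : ℝ, t * d - t ^ 2 * a ≤ M) : 0 ≤ a := by
  by_contra ha
  push Not at ha
  have h1 := h ((|M| + 1 + |d|) / (-a) + 1)
  have h2 := h (-((|M| + 1 + |d|) / (-a) + 1))
  set t := (|M| + 1 + |d|) / (-a) + 1 with ht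
  have h3 : (t - 1) * (-a) = |M| + 1 + |d| := by
    rw [ht, add_sub_cancel_right, div_mul_cancel₀ _ (neg_ne_zero.2 ha.ne)]
  have h4 : 1 ≤ t := by
    rw [ht]
    have : 0 ≤ (|M| + 1 + |d|) / (-a) := by
      apply div_nonneg <;> [positivity; linarith]
    linarith
  have h5 : - (t ^ 2 * a) ≤ M := by nlinarith
  have h6 : M ≤ |M| := le_abs_self M
  have h7 := abs_nonneg d
  nlinarith [mul_nonneg (sub_nonneg.2 h4) (by linarith : 0 ≤ -a),
    mul_nonneg (by linarith : 0 ≤ t) (mul_nonneg (sub_nonneg.2 h4) (by linarith : 0 ≤ -a))]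

/-- if `E` is positive definite, then `p = pFun τ c w β E` solves (FP), is
strictly convex, and is the unique solution of (FP) in the class of quadratic functions
whose leading coefficient is invertible. -/
theorem existence_and_partial_uniqueness_positive_definite
    {X : Type*} [NormedAddCommGroup X] [InnerProductSpace ℝ X] [CompleteSpace X] [Nontrivial X]
    (τ : ℝ) (hτ : 0 < τ) (c w : X) (β : ℝ) (E : X ≃L[ℝ] X)
    (hE_sa : ∀ x y : X, (⟪E x, y⟫ : ℝ) = ⟪x, E y⟫)
    (hE_pd : ∀ x : X, x ≠ 0 → 0 < (⟪E x, x⟫ : ℝ)) :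
    SolvesFP τ c w β E (fun x => ((pFun τ c w β E x : ℝ) : EReal)) ∧
      StrictConvexOn ℝ Set.univ (pFun τ c w β E) ∧
      ∀ (f : X → ℝ) (A : X →L[ℝ] X),
        (∀ x y : X, (⟪A x, y⟫ : ℝ) = ⟪x, A y⟫) → A ≠ 0 → Function.Bijective A →
        ∀ (b : X) (γ : ℝ),
          (∀ x : X, f x = (1 : ℝ) / 2 * ⟪A x, x⟫ + ⟪b, x⟫ + γ) →
          SolvesFP τ c w β E (fun x => ((f x : ℝ) : EReal)) →
          f = pFun τ c w β E := by
  classical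
  obtain ⟨s, hs0, hsτ, hsdef⟩ : ∃ s : ℝ, 0 < s ∧ τ = s ^ 2 ∧ Real.sqrt τ = s :=
    ⟨Real.sqrt τ, Real.sqrt_pos.2 hτ, (Real.sq_sqrt hτ.le).symm, rfl⟩
  have hE0 : ∀ x : X, 0 ≤ (⟪E x, x⟫ : ℝ) := by
    intro x
    by_cases hx : x = 0
    · simp [hx]
    · exact (hE_pd x hx).le
  have hs1 : (1 + s) ≠ 0 := by positivity
  refine ⟨?_, ?_, ?_⟩
  · intro x
    set b : X := (1 + s)⁻¹ • (w + s • c) with hb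
    set e : X := E.symm (c - w) with he
    have hEe : E e = c - w := by simp [he]
    have hcw : c = E e + w := by rw [hEe]; abel
    have hbw : b = w + (s / (1 + s)) • E e := by
      rw [hb, hcw]
      match_scalars <;> field_simp
    have hc := conj_quad (s • (E : X →L[ℝ] X))
      (by intro x y; simp [inner_smul_left, inner_smul_right, hE_sa])
      (by intro x; simpa [inner_smul_left] using mul_nonneg hs0.le (hE0 x))
      b _ (pFun τ c w β E) (by intro x; simp only [pFun, hsdef, hb]; rfl)
      (E x + c) (s⁻¹ • x + (s⁻¹ * (1 + s)⁻¹) • e)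
      (by
        rw [hbw, hcw]
        simp only [ContinuousLinearMap.smul_apply, ContinuousLinearEquiv.coe_coe, map_add, map_smul]
        match_scalars <;> field_simp <;> ring)
    rw [hc, ← EReal.coe_mul, ← EReal.coe_add, ← EReal.coe_add, EReal.coe_eq_coe_iff]
    simp only [pFun, hsdef]
    rw [← hb, ← he, hbw, ← hEe, hsτ]
    have h1 : (⟪E x, e⟫ : ℝ) = ⟪E e, x⟫ := by rw [hE_sa x e, real_inner_comm]
    simp only [ContinuousLinearMap.smul_apply, ContinuousLinearEquiv.coe_coe, map_add, map_smul,
      inner_add_left, inner_add_right, real_inner_smul_left, real_inner_smul_right, h1]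
    field_simp
    ring
  · refine ⟨convex_univ, ?_⟩
    intro x _ y _ hxy a b ha hb hab
    have h := hE_pd (x - y) (sub_ne_zero.2 hxy)
    have h1 : (⟪E y, x⟫ : ℝ) = ⟪E x, y⟫ := by rw [hE_sa y x, real_inner_comm]
    have h2 : 0 < a * b * s * ⟪E (x - y), x - y⟫ := by positivity
    simp only [pFun, hsdef]
    simp only [map_add, map_smul, map_sub, smul_eq_mul, inner_sub_left, inner_sub_right,
      inner_add_left, inner_add_right, real_inner_smul_left, real_inner_smul_right, h1] at h2 ⊢
    obtain rfl : b = 1 - a := by linarith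
    nlinarith
  · intro f A hA _ hbij b γ hf hFP
    -- finiteness of the conjugate
    have hp : ∀ x : X, 0 ≤ (⟪A x, x⟫ : ℝ) := by
      intro x
      have h0 := hFP 0
      have hub : ∀ t : ℝ, (((⟪E 0 + c, t • x⟫ : ℝ) - f (t • x) : ℝ) : EReal) ≤
          fenchelConj (fun x => ((f x : ℝ) : EReal)) (E 0 + c) := by
        intro t
        rw [EReal.coe_sub]
        exact le_iSup (fun x : X => ((⟪E 0 + c, x⟫ : ℝ) : EReal) - ((f x : ℝ) : EReal)) (t • x)
      generalize fenchelConj (fun x => ((f x : ℝ) : EReal)) (E 0 + c) = F at h0 hub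
      induction F with
      | bot => exact absurd (hub 0) (by simp only [le_bot_iff]; exact EReal.coe_ne_bot _)
      | top =>
        rw [EReal.coe_mul_top_of_pos hτ, EReal.top_add_coe, EReal.top_add_coe] at h0
        exact absurd h0 (EReal.coe_ne_top _)
      | coe M =>
        have := nonneg_of_bdd (1 / 2 * ⟪A x, x⟫) (⟪c, x⟫ - ⟪b, x⟫) (M + γ) (by
          intro t
          have h := hub t
          rw [EReal.coe_le_coe_iff, hf] at h
          simp only [map_smul, map_zero, zero_add, real_inner_smul_left,
            real_inner_smul_right] at h
          linarith)
        linarith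
    let B := (LinearEquiv.ofBijective (A : X →ₗ[ℝ] X) hbij).symm
    have hAB : ∀ x, A (B x) = x := fun x =>
      (LinearEquiv.ofBijective (A : X →ₗ[ℝ] X) hbij).apply_symm_apply x
    obtain ⟨u, hu⟩ : ∃ u, A u = c - b := ⟨B (c - b), hAB _⟩
    have key : ∀ x v : X, A v = E x → (1 : ℝ) / 2 * ⟪A x, x⟫ + ⟪b, x⟫ + γ =
        τ * (1 / 2 * (⟪E x, v⟫ + 2 * ⟪E x, u⟫ + ⟪A u, u⟫) - γ) + ⟪w, x⟫ + β := by
      intro x v hv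
      have h := hFP x
      rw [conj_quad A hA hp b γ f hf (E x + c) (v + u) (by rw [map_add, hv, hu]; abel),
        ← EReal.coe_mul, ← EReal.coe_add, ← EReal.coe_add, EReal.coe_eq_coe_iff, hf] at h
      rw [h]
      have h1 : (⟪A u, v⟫ : ℝ) = ⟪E x, u⟫ := by rw [hA u v, hv, real_inner_comm]
      simp only [map_add, inner_add_left, inner_add_right, hv, h1]
      ring
    have k0 := key 0 0 (by simp)
    simp only [map_zero, inner_zero_left, inner_zero_right] at k0
    have kn : ∀ x v : X, A v = E x → (1 : ℝ) / 2 * ⟪A x, x⟫ - ⟪b, x⟫ + γ =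
        τ * (1 / 2 * (⟪E x, v⟫ - 2 * ⟪E x, u⟫ + ⟪A u, u⟫) - γ) - ⟪w, x⟫ + β := by
      intro x v hv
      have := key (-x) (-v) (by simp [hv])
      simp only [map_neg, inner_neg_left, inner_neg_right] at this
      linarith
    have hlin : b = τ • E u + w := by
      apply ext_inner_right ℝ
      intro x
      have h1 := key x _ (hAB _)
      have h2 := kn x _ (hAB _)
      have h3 : (⟪E x, u⟫ : ℝ) = ⟪E u, x⟫ := by rw [hE_sa x u, real_inner_comm]
      rw [inner_add_left, real_inner_smul_left]
      rw [h3] at h1 h2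
      linarith
    have hq : ∀ x : X, (⟪A x, x⟫ : ℝ) = τ * ⟪E x, B (E x)⟫ := by
      intro x
      have h1 := key x _ (hAB _)
      have h2 := kn x _ (hAB _)
      linarith
    have hBs : ∀ x y : X, (⟪x, B y⟫ : ℝ) = ⟪B x, y⟫ := by
      intro x y
      conv_lhs => rw [← hAB x]
      rw [hA, hAB]
    have hop : ∀ x : X, A x = τ • E (B (E x)) := by
      intro x
      apply ext_inner_right ℝ
      intro y
      have h1 := hq (x + y)
      have h2 := hq x
      have h3 := hq y
      have h4 : (⟪A y, x⟫ : ℝ) = ⟪A x, y⟫ := by rw [hA y x, real_inner_comm]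
      have h5 : (⟪E x, B (E y)⟫ : ℝ) = ⟪E (B (E x)), y⟫ := by rw [hBs, hE_sa]
      have h6 : (⟪E y, B (E x)⟫ : ℝ) = ⟪E (B (E x)), y⟫ := by rw [real_inner_comm, hE_sa]
      simp only [map_add, inner_add_left, inner_add_right, h4, h5, h6] at h1
      rw [real_inner_smul_left]
      linarith
    have hAE : ∀ x : X, A x = s • E x := by
      intro x
      set v := τ • B (E x) - s • x with hv
      have hEv : E v = A x - s • E x := by
        rw [hv, map_sub, map_smul, map_smul, ← hop]
      have hAv : A v = -(s • E v) := by
        rw [hEv, hv, map_sub, map_smul, map_smul, hAB, hsτ]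
        module
      have h1 := hp v
      rw [hAv, inner_neg_left, real_inner_smul_left] at h1
      by_cases hv0 : v = 0
      · rw [hv0, map_zero] at hEv
        exact sub_eq_zero.1 hEv.symm
      · have := mul_pos hs0 (hE_pd v hv0)
        linarith
    have hu' : s • E u = c - b := by rw [← hAE, hu]
    have hcw : c - w = (s * (1 + s)) • E u := by
      have : c = s • E u + b := by rw [hu']; abel
      rw [this, hlin, hsτ]
      module
    have hbb : b = (1 + s)⁻¹ • (w + s • c) := by
      have : c = w + (s * (1 + s)) • E u := by rw [← hcw]; abel
      rw [this, hlin, hsτ]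
      match_scalars <;> field_simp
    funext x
    rw [hf]
    simp only [pFun, hsdef]
    rw [← hbb, hcw, map_smul, E.symm_apply_apply, hAE]
    congr 1
    rw [hAE u] at k0
    simp only [real_inner_smul_left, real_inner_smul_right] at k0 ⊢
    rw [hsτ] at k0 ⊢
    rw [eq_div_iff (by positivity)]
    linear_combination (1 + s) ^ 2 * k0
end

section
/- Let E : X → X be an invertible, positive definite continuous linear operator, let c ∈ X and β ∈ ℝ. Then the equation f(x) = f*(Ex + c) + ⟨c, x⟩ + β (for all x ∈ X) has a unique solution f : X → [-∞,+∞], namely the strictly convex quadratic function f(x) = (1/2)⟨Ex, x⟩ + ⟨c, x⟩ + β/2. -/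
open scoped RealInnerProductSpace

/-- if `E` is positive definite (and invertible) then the equation
`f(x) = f*(Ex + c) + ⟪c, x⟫ + β` has a unique solution `f : X → [-∞,∞]`, namely the
strictly convex quadratic function `f(x) = (1/2)⟪Ex, x⟫ + ⟪c, x⟫ + β/2`. -/
theorem unique_solution_tau_one_w_eq_c
    {X : Type*} [NormedAddCommGroup X] [InnerProductSpace ℝ X] [CompleteSpace X] [Nontrivial X]
    (c : X) (β : ℝ) (E : X ≃L[ℝ] X)
    (hE_sa : ∀ x y : X, (⟪E x, y⟫ : ℝ) = ⟪x, E y⟫)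
    (hE_pd : ∀ x : X, x ≠ 0 → 0 < (⟪E x, x⟫ : ℝ)) :
    (∀ x : X,
      (((1 : ℝ) / 2 * ⟪E x, x⟫ + ⟪c, x⟫ + β / 2 : ℝ) : EReal)
        = fenchelConj (fun y => (((1 : ℝ) / 2 * ⟪E y, y⟫ + ⟪c, y⟫ + β / 2 : ℝ) : EReal))
            (E x + c)
          + ((⟪c, x⟫ : ℝ) : EReal) + (β : EReal)) ∧
    (∀ f : X → EReal,
      (∀ x : X, f x = fenchelConj f (E x + c) + ((⟪c, x⟫ : ℝ) : EReal) + (β : EReal)) →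
      f = fun x => (((1 : ℝ) / 2 * ⟪E x, x⟫ + ⟪c, x⟫ + β / 2 : ℝ) : EReal)) ∧
    StrictConvexOn ℝ Set.univ
      (fun x : X => (1 : ℝ) / 2 * ⟪E x, x⟫ + ⟪c, x⟫ + β / 2) := by
  have hnn : ∀ z : X, 0 ≤ (⟪E z, z⟫ : ℝ) := by
    intro z
    by_cases hz : z = 0
    · simp [hz]
    · exact (hE_pd z hz).le
  have hsym : ∀ x y : X, (⟪E x, y⟫ : ℝ) = ⟪E y, x⟫ := by
    intro x y
    rw [hE_sa, real_inner_comm]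
  have hconj : ∀ x : X,
      fenchelConj (fun y => (((1 : ℝ) / 2 * ⟪E y, y⟫ + ⟪c, y⟫ + β / 2 : ℝ) : EReal)) (E x + c)
        = (((1 : ℝ) / 2 * ⟪E x, x⟫ - β / 2 : ℝ) : EReal) := by
    intro x
    apply le_antisymm
    · refine iSup_le fun y => ?_
      rw [← EReal.coe_sub, EReal.coe_le_coe_iff, inner_add_left]
      have h := hnn (x - y)
      rw [map_sub, inner_sub_left, inner_sub_right, inner_sub_right, hsym y x] at h
      linarith
    · refine le_trans ?_ (le_iSup _ x)
      rw [← EReal.coe_sub, EReal.coe_le_coe_iff, inner_add_left]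
      linarith
  have hq : ∀ x : X,
      (((1 : ℝ) / 2 * ⟪E x, x⟫ + ⟪c, x⟫ + β / 2 : ℝ) : EReal)
        = fenchelConj (fun y => (((1 : ℝ) / 2 * ⟪E y, y⟫ + ⟪c, y⟫ + β / 2 : ℝ) : EReal))
            (E x + c)
          + ((⟪c, x⟫ : ℝ) : EReal) + (β : EReal) := by
    intro x
    rw [hconj, ← EReal.coe_add, ← EReal.coe_add, EReal.coe_eq_coe_iff]
    ring
  refine ⟨hq, ?_, ?_⟩
  · intro f hf
    have hge : ∀ x : X, (((1 : ℝ) / 2 * ⟪E x, x⟫ + ⟪c, x⟫ + β / 2 : ℝ) : EReal) ≤ f x := by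
      intro x
      have h1 : ((⟪E x + c, x⟫ : ℝ) : EReal) - f x ≤ fenchelConj f (E x + c) :=
        le_iSup (fun y : X => ((⟪E x + c, y⟫ : ℝ) : EReal) - f y) x
      have h2 : ((⟪E x + c, x⟫ : ℝ) : EReal) - f x + ((⟪c, x⟫ : ℝ) : EReal) + (β : EReal) ≤ f x := by
        conv_rhs => rw [hf x]
        gcongr
      generalize f x = t at h2
      induction t with
      | bot => simp [← EReal.coe_add] at h2
      | top => exact le_top
      | coe r =>
        rw [← EReal.coe_sub, ← EReal.coe_add, ← EReal.coe_add, EReal.coe_le_coe_iff,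
          inner_add_left] at h2
        rw [EReal.coe_le_coe_iff]
        linarith
    funext x
    refine le_antisymm ?_ (hge x)
    rw [hf x, hq x]
    have h3 : fenchelConj f (E x + c) ≤
        fenchelConj (fun y => (((1 : ℝ) / 2 * ⟪E y, y⟫ + ⟪c, y⟫ + β / 2 : ℝ) : EReal))
            (E x + c) :=
      iSup_mono fun y => EReal.sub_le_sub le_rfl (hge y)
    gcongr
  · refine ⟨convex_univ, ?_⟩
    intro x _ y _ hxy a b ha hb hab
    have h := hE_pd (x - y) (sub_ne_zero.mpr hxy)
    rw [map_sub, inner_sub_left, inner_sub_right, inner_sub_right, hsym y x] at h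
    simp only [map_add, map_smul, inner_add_left, inner_add_right, real_inner_smul_left,
      real_inner_smul_right, smul_eq_mul, hsym y x]
    have hb' : b = 1 - a := by linarith
    subst hb'
    nlinarith [mul_pos (mul_pos ha hb) h]
end

section
/- Suppose τ ≠ 1 and the invertible continuous linear operator E is positive definite. Let f : X → [-∞,+∞] be a solution of the fixed point equation (FP). If f is real-valued, twice (Fréchet) differentiable on X, and its second derivative is continuous at the point x₀ := (1/(1 − τ))(E⁻¹w − E⁻¹c), then f is strictly convex and quadratic. -/
open scoped RealInnerProductSpace

/-- gradient inequality for convex differentiable functions -/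
theorem aux_grad_ineq {X : Type*} [NormedAddCommGroup X] [InnerProductSpace ℝ X]
    (F : X → ℝ) (hconv : ConvexOn ℝ Set.univ F) (hdiff : Differentiable ℝ F) (x x' : X) :
    F x + fderiv ℝ F x (x' - x) ≤ F x' := by
  have h1 : HasDerivAt (fun t : ℝ => F (x + t • (x' - x))) (fderiv ℝ F x (x' - x)) 0 := by
    have h := (hdiff x).hasFDerivAt.hasLineDerivAt (x' - x)
    exact h
  have h2 : ConvexOn ℝ Set.univ (fun t : ℝ => F (x + t • (x' - x))) := by
    refine ⟨convex_univ, fun a _ b _ p q hp hq hpq => ?_⟩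
    have := hconv.2 (Set.mem_univ (x + a • (x' - x))) (Set.mem_univ (x + b • (x' - x))) hp hq hpq
    have e : x + (p • a + q • b) • (x' - x)
        = p • (x + a • (x' - x)) + q • (x + b • (x' - x)) := by
      have hq' : q = 1 - p := by linarith
      subst hq'
      simp only [smul_eq_mul]
      module
    show F (x + (p • a + q • b) • (x' - x)) ≤ _
    rw [e]
    exact this
  have h3 := h2.le_slope_of_hasDerivAt (Set.mem_univ (0 : ℝ)) (Set.mem_univ (1 : ℝ)) one_pos h1
  simp [slope] at h3
  rw [map_sub]
  linarith

/-- a homogeneous map differentiable at zero is linear -/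
theorem aux_homog {X : Type*} [NormedAddCommGroup X] [NormedSpace ℝ X]
    (R : X → X) (L : X →L[ℝ] X) (hL : HasFDerivAt R L 0) (h0 : R 0 = 0)
    (s : ℝ) (hs0 : 0 < s) (hs1 : s < 1) (hR : ∀ u, R (s • u) = s • R u) (u : X) : R u = L u := by
  have hn : ∀ n : ℕ, R ((s ^ n) • u) = s ^ n • R u := by
    intro n
    induction n with
    | zero => simp
    | succ k ih => rw [pow_succ', mul_smul, hR, ih, mul_smul]
  have hlim := hL.lim u (c := fun n : ℕ => (s⁻¹) ^ n) (l := Filter.atTop) (by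
    have h := tendsto_pow_atTop_atTop_of_one_lt ((one_lt_inv₀ hs0).2 hs1)
    refine h.congr fun n => ?_
    rw [Real.norm_of_nonneg (by positivity)])
  refine tendsto_nhds_unique (tendsto_const_nhds.congr fun n => ?_) hlim
  have : s ^ n ≠ 0 := by positivity
  simp only [zero_add, h0, sub_zero, inv_pow, inv_inv, hn]
  rw [smul_smul, inv_mul_cancel₀ this, one_smul]

theorem aux_conj {X : Type*} [NormedAddCommGroup X] [InnerProductSpace ℝ X]
    (τ : ℝ) (hτ : 0 < τ) (c w : X) (β : ℝ) (E : X ≃L[ℝ] X)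
    (f : X → EReal) (hf : SolvesFP τ c w β E f)
    (F : X → ℝ) (hF : ∀ x : X, f x = ((F x : ℝ) : EReal)) :
    ∃ G : X → ℝ, (∀ y x, ⟪y, x⟫ - F x ≤ G y) ∧
      (∀ y m, (∀ x, ⟪y, x⟫ - F x ≤ m) → G y ≤ m) ∧
      ∀ x, F x = τ * G (E x + c) + ⟪w, x⟫ + β := by
  have hreal : ∀ y, ∃ r : ℝ, fenchelConj f y = (r : EReal) := by
    intro y
    have h := hf (E.symm (y - c))
    rw [hF] at h
    simp only [ContinuousLinearEquiv.apply_symm_apply, sub_add_cancel] at h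
    induction hy : fenchelConj f y with
    | bot =>
      rw [hy, EReal.coe_mul_bot_of_pos hτ] at h
      simp at h
    | top =>
      rw [hy, EReal.coe_mul_top_of_pos hτ] at h
      simp at h
    | coe r => exact ⟨r, rfl⟩
  choose G hG using hreal
  refine ⟨G, fun y x => ?_, fun y m hm => ?_, fun x => ?_⟩
  · have : ((⟪y, x⟫ : ℝ) : EReal) - f x ≤ fenchelConj f y :=
      le_iSup (fun x : X => ((⟪y, x⟫ : ℝ) : EReal) - f x) x
    rw [hF, hG] at this
    exact_mod_cast this
  · have : fenchelConj f y ≤ (m : EReal) := by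
      refine iSup_le fun x => ?_
      rw [hF]
      exact_mod_cast hm x
    rw [hG] at this
    exact_mod_cast this
  · have := hf x
    rw [hF, hG] at this
    exact_mod_cast this

/-- if `τ ≠ 1`, `E` is positive definite, and a real-valued solution `F` of
(FP) is twice (Fréchet) differentiable on `X` with second derivative continuous at
`x₀ = (1/(1−τ))(E⁻¹w − E⁻¹c)`, then `F` is strictly convex and quadratic. -/
theorem twice_differentiable_solution_is_quadratic
    {X : Type*} [NormedAddCommGroup X] [InnerProductSpace ℝ X] [CompleteSpace X] [Nontrivial X]
    (τ : ℝ) (hτ : 0 < τ) (hτ1 : τ ≠ 1) (c w : X) (β : ℝ) (E : X ≃L[ℝ] X)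
    (hE_sa : ∀ x y : X, (⟪E x, y⟫ : ℝ) = ⟪x, E y⟫)
    (hE_pd : ∀ x : X, x ≠ 0 → 0 < (⟪E x, x⟫ : ℝ))
    (f : X → EReal) (hf : SolvesFP τ c w β E f)
    (F : X → ℝ) (hF : ∀ x : X, f x = ((F x : ℝ) : EReal))
    (hdiff : Differentiable ℝ F)
    (hdiff2 : Differentiable ℝ (fderiv ℝ F))
    (hcont : ContinuousAt (fderiv ℝ (fderiv ℝ F))
      ((1 / (1 - τ)) • (E.symm w - E.symm c))) :
    StrictConvexOn ℝ Set.univ F ∧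
      ∃ A : X →L[ℝ] X, (∀ x y : X, (⟪A x, y⟫ : ℝ) = ⟪x, A y⟫) ∧ A ≠ 0 ∧
        ∃ b : X, ∃ γ : ℝ,
          ∀ x : X, F x = (1 : ℝ) / 2 * ⟪A x, x⟫ + ⟪b, x⟫ + γ := by
  obtain ⟨G, hG1, hG2, hFG⟩ := aux_conj τ hτ c w β E f hf F hF
  have hGc : ∀ y y' : X, ∀ p q : ℝ, 0 ≤ p → 0 ≤ q → p + q = 1 →
      G (p • y + q • y') ≤ p * G y + q * G y' := by
    intro y y' p q hp hq hpq
    refine hG2 _ _ fun x => ?_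
    have h1 := mul_le_mul_of_nonneg_left (hG1 y x) hp
    have h2 := mul_le_mul_of_nonneg_left (hG1 y' x) hq
    rw [inner_add_left, real_inner_smul_left, real_inner_smul_left]
    have : F x = (p + q) * F x := by rw [hpq, one_mul]
    rw [this]
    linarith
  have hconv : ConvexOn ℝ Set.univ F := by
    refine ⟨convex_univ, fun x _ x' _ p q hp hq hpq => ?_⟩
    have h := mul_le_mul_of_nonneg_left (hGc (E x + c) (E x' + c) p q hp hq hpq) hτ.le
    have e : E (p • x + q • x') + c = p • (E x + c) + q • (E x' + c) := by
      have : c = (p + q) • c := by rw [hpq, one_smul]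
      nth_rewrite 1 [this]
      rw [map_add, map_smul, map_smul]
      module
    rw [hFG, hFG x, hFG x', e, inner_add_right, real_inner_smul_right, real_inner_smul_right]
    have : β = (p + q) * β := by rw [hpq, one_mul]
    simp only [smul_eq_mul]
    linarith
  obtain ⟨T, hTdef⟩ : ∃ T : X → X, T = fun x =>
    (InnerProductSpace.toDual ℝ X).symm (fderiv ℝ F x) := ⟨_, rfl⟩
  have hT : ∀ x v, ⟪T x, v⟫ = fderiv ℝ F x v := by
    intro x v
    rw [hTdef]
    exact InnerProductSpace.toDual_symm_apply
  have hTd : Differentiable ℝ T := by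
    rw [hTdef]
    intro x
    exact ((InnerProductSpace.toDual ℝ X).symm.toContinuousLinearEquiv.differentiableAt.comp x
      (hdiff2 x))
  have hgrad : ∀ x x', F x + ⟪T x, x' - x⟫ ≤ F x' := by
    intro x x'
    rw [hT]
    exact aux_grad_ineq F hconv hdiff x x'
  have hGT : ∀ z, G (T z) ≤ ⟪T z, z⟫ - F z := by
    intro z
    refine hG2 _ _ fun x => ?_
    have := hgrad z x
    rw [inner_sub_right] at this
    linarith
  have hmin : ∀ z y, (∀ x', F z - ⟪y, z⟫ ≤ F x' - ⟪y, x'⟫) → T z = y := by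
    intro z y h
    have hl : IsLocalMin (fun x => F x - ⟪y, x⟫) z := Filter.Eventually.of_forall h
    have hd : HasFDerivAt (fun x => F x - ⟪y, x⟫) (fderiv ℝ F z - innerSL ℝ y) z :=
      (hdiff z).hasFDerivAt.sub (innerSL ℝ y).hasFDerivAt
    have h0 := hl.hasFDerivAt_eq_zero hd
    refine ext_inner_right ℝ fun v => ?_
    have := congrArg (fun l : X →L[ℝ] ℝ => l v) h0
    simp only [ContinuousLinearMap.sub_apply, innerSL_apply_apply,
      ContinuousLinearMap.zero_apply] at this
    rw [hT]
    linarith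
  obtain ⟨S, hSdef⟩ : ∃ S : X → X, S = fun x => τ⁻¹ • E.symm (T x - w) := ⟨_, rfl⟩
  have hTS : ∀ x, T x = τ • E (S x) + w := by
    intro x
    rw [hSdef]
    simp only [map_smul, ContinuousLinearEquiv.apply_symm_apply]
    rw [smul_smul, mul_inv_cancel₀ hτ.ne', one_smul, sub_add_cancel]
  have hTSx : ∀ x, T (S x) = E x + c := by
    intro x
    refine hmin _ _ fun x' => ?_
    have hG1' := hG1 (E x + c) x'
    obtain ⟨v, hv⟩ : ∃ v, E v + c = T (S x) := ⟨E.symm (T (S x) - c), by simp⟩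
    have h1 := hgrad x v
    rw [hFG x, hFG v, hTS x, inner_add_left, real_inner_smul_left, hE_sa, map_sub] at h1
    have e : E v - E x = T (S x) - (E x + c) := by rw [← hv]; abel
    rw [e, hv] at h1
    have h2 := hGT (S x)
    have h3 : τ * (G (E x + c) + ⟪S x, T (S x) - (E x + c)⟫) ≤ τ * G (T (S x)) := by
      rw [inner_sub_right w] at h1
      linarith
    have h4 := le_of_mul_le_mul_left h3 hτ
    rw [inner_sub_right, real_inner_comm, real_inner_comm (E x + c)] at h4
    linarith
  have hSS : ∀ x, S (S x) = τ⁻¹ • (x + E.symm (c - w)) := by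
    intro x
    have : S (S x) = τ⁻¹ • E.symm (T (S x) - w) := by rw [hSdef]
    rw [this, hTSx, add_sub_assoc, map_add, ContinuousLinearEquiv.symm_apply_apply]
  obtain ⟨x₀, hx₀⟩ : ∃ x₀ : X, x₀ = (1 / (1 - τ)) • (E.symm w - E.symm c) := ⟨_, rfl⟩
  have h1τ : (1 - τ) ≠ 0 := sub_ne_zero.2 hτ1.symm
  have hd : E.symm (c - w) = (τ - 1) • x₀ := by
    rw [hx₀, smul_smul, map_sub]
    have : (τ - 1) * (1 / (1 - τ)) = -1 := by field_simp; ring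
    rw [this]
    module
  have hSS' : ∀ u, S (S (x₀ + u)) = x₀ + τ⁻¹ • u := by
    intro u
    rw [hSS, hd]
    have : x₀ + u + (τ - 1) • x₀ = τ • x₀ + u := by module
    rw [this, smul_add, smul_smul, inv_mul_cancel₀ hτ.ne', one_smul]
  obtain ⟨R, hRdef⟩ : ∃ R : X → X, R = fun u => S (x₀ + u) - x₀ := ⟨_, rfl⟩
  have hSR : ∀ u, S (x₀ + u) = x₀ + R u := by
    intro u
    rw [hRdef]; simp
  have hRR : ∀ u, R (R u) = τ⁻¹ • u := by
    intro u
    have := hSS' u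
    rw [hSR, hSR] at this
    exact add_left_cancel this
  have hRτ : ∀ u, R (τ⁻¹ • u) = τ⁻¹ • R u := by
    intro u
    rw [← hRR u, hRR (R u)]
  have hRτ' : ∀ u, R (τ • u) = τ • R u := by
    intro u
    have := hRτ (τ • u)
    rw [smul_smul, inv_mul_cancel₀ hτ.ne', one_smul] at this
    rw [this, smul_smul, mul_inv_cancel₀ hτ.ne', one_smul]
  have hR0 : R 0 = 0 := by
    have := hRτ' 0
    rw [smul_zero] at this
    have h2 : (1 - τ) • R 0 = 0 := by
      rw [sub_smul, one_smul, ← this, sub_self]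
    exact (smul_eq_zero.1 h2).resolve_left h1τ
  have hSd : Differentiable ℝ S := by
    rw [hSdef]
    intro x
    exact (E.symm.differentiableAt.comp x ((hTd x).sub_const w)).const_smul τ⁻¹
  have hRd : Differentiable ℝ R := by
    rw [hRdef]
    intro u
    exact ((hSd (x₀ + u)).comp u ((differentiableAt_const x₀).add differentiableAt_id)).sub_const x₀
  obtain ⟨L, hL⟩ : ∃ L : X →L[ℝ] X, HasFDerivAt R L 0 := ⟨_, (hRd 0).hasFDerivAt⟩
  have hRL : ∀ u, R u = L u := by
    intro u
    rcases lt_or_gt_of_ne hτ1 with h | h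
    · exact aux_homog R L hL hR0 τ hτ h hRτ' u
    · exact aux_homog R L hL hR0 τ⁻¹ (inv_pos.2 hτ) (inv_lt_one_of_one_lt₀ h) hRτ u
  have hSL : ∀ x, S x = x₀ + L (x - x₀) := by
    intro x
    rw [← hRL, ← hSR, add_sub_cancel]
  obtain ⟨A, hAdef⟩ : ∃ A : X →L[ℝ] X, A = τ • ((E : X →L[ℝ] X).comp L) := ⟨_, rfl⟩
  have hA : ∀ x, A x = τ • E (L x) := by
    intro x; rw [hAdef]; rfl
  have hTA : ∀ x, T x = A x + T 0 := by
    intro x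
    rw [hTS x, hTS 0, hSL x, hSL 0, hA]
    simp only [map_sub, map_add, map_zero]
    module
  have hAinj : ∀ x, A x = 0 → x = 0 := by
    intro x hx
    rw [hA] at hx
    have h1 := (smul_eq_zero.1 hx).resolve_left hτ.ne'
    have h2 : L x = 0 := by simpa using h1
    have h3 := hRR x
    rw [hRL, hRL, h2, map_zero] at h3
    exact (smul_eq_zero.1 h3.symm).resolve_left (inv_ne_zero hτ.ne')
  have hF' : ∀ x, HasFDerivAt F (innerSL ℝ (A x + T 0)) x := by
    intro x
    have : fderiv ℝ F x = innerSL ℝ (A x + T 0) := by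
      ext v
      rw [← hTA, innerSL_apply_apply, hT]
    rw [← this]
    exact (hdiff x).hasFDerivAt
  have hsymm : ∀ x y : X, (⟪A x, y⟫ : ℝ) = ⟪x, A y⟫ := by
    intro x y
    have h2 : HasFDerivAt (fun x => innerSL ℝ (A x + T 0)) ((innerSL ℝ).comp A) 0 :=
      ((innerSL ℝ).hasFDerivAt).comp (0 : X) (A.hasFDerivAt.add_const (T 0))
    have := second_derivative_symmetric hF' h2 x y
    simp only [ContinuousLinearMap.comp_apply, innerSL_apply_apply] at this
    rw [this, real_inner_comm]
  have hquad : ∀ x, F x = (1 : ℝ) / 2 * ⟪A x, x⟫ + ⟪T 0, x⟫ + F 0 := by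
    have hd0 : ∀ x, HasFDerivAt (fun x => F x - ((1 : ℝ) / 2 * ⟪A x, x⟫ + ⟪T 0, x⟫))
        (0 : X →L[ℝ] ℝ) x := by
      intro x
      have h1 := ((A.hasFDerivAt (x := x)).inner ℝ (hasFDerivAt_id x)).const_mul ((1 : ℝ) / 2)
      have h2 := (hF' x).sub (h1.add (innerSL ℝ (T 0)).hasFDerivAt)
      refine h2.congr_fderiv ?_
      ext v
      have e1 : ⟪A v, x⟫ = ⟪A x, v⟫ := by rw [hsymm, real_inner_comm]
      simp [inner_add_left, e1]
      ring
    intro x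
    have := is_const_of_fderiv_eq_zero (𝕜 := ℝ) (fun x => (hd0 x).differentiableAt)
      (fun x => (hd0 x).fderiv) x 0
    simp at this
    linarith
  have hpsd : ∀ x, 0 ≤ ⟪A x, x⟫ := by
    intro x
    have h1 := hgrad 0 x
    rw [hquad x, sub_zero] at h1
    linarith
  have hpd : ∀ x, x ≠ 0 → 0 < ⟪A x, x⟫ := by
    intro x hx
    refine lt_of_le_of_ne (hpsd x) fun h0 => hx (hAinj x ?_)
    have hT0 : T x = T 0 := by
      refine hmin x (T 0) fun x' => ?_
      rw [hquad x, hquad x', ← h0]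
      have := hpsd x'
      linarith
    rw [hTA x] at hT0
    simpa using hT0
  refine ⟨⟨convex_univ, fun x _ y _ hxy p q hp hq hpq => ?_⟩, A, hsymm, ?_, T 0, F 0, hquad⟩
  · have h := mul_pos (mul_pos hp hq) (hpd (x - y) (sub_ne_zero.2 hxy))
    have e1 : ⟪A y, x⟫ = ⟪A x, y⟫ := by rw [hsymm, real_inner_comm]
    have hq' : q = 1 - p := by linarith
    rw [hquad, hquad x, hquad y]
    simp only [map_sub, map_add, map_smul, inner_sub_left, inner_sub_right, inner_add_left,
      inner_add_right, real_inner_smul_left, real_inner_smul_right, smul_eq_mul, e1] at h ⊢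
    subst hq'
    nlinarith
  · intro h0
    obtain ⟨x, hx⟩ := exists_ne (0 : X)
    exact hx (hAinj x (by rw [h0]; rfl))
end

section
/- Assume X is a finite-dimensional real Hilbert space, E : X → X is an invertible positive definite linear operator, τ > 0 with τ ≠ 1, and c, w ∈ X, β ∈ ℝ. Consider the class of functions f : X → ℝ that are twice differentiable on X with second derivative continuous at the point x₀ := (1/(1 − τ))(E⁻¹w − E⁻¹c). Then the fixed point equation (FP) has exactly one solution in this class, namely the strictly convex quadratic function p(x) = (1/2)⟨√τ·Ex, x⟩ + ⟨(w + √τ·c)/(1 + √τ), x⟩ + (β(1 + √τ)² + (√τ/2)⟨c − w, E⁻¹(c − w)⟩)/((1 + √τ)²(τ + 1)). -/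
open scoped RealInnerProductSpace

lemma fp_iff {X : Type*} [NormedAddCommGroup X] [InnerProductSpace ℝ X]
    (τ : ℝ) (hτ : 0 < τ) (c w : X) (β : ℝ) (E : X ≃L[ℝ] X) (F : X → ℝ) :
    SolvesFP τ c w β E (fun x => ((F x : ℝ) : EReal)) ↔
      ∀ x, IsLUB (Set.range fun z => ⟪E x + c, z⟫ - F z) ((F x - ⟪w, x⟫ - β) / τ) := by
  unfold SolvesFP
  refine forall_congr' fun x => ?_
  have key : fenchelConj (fun x => ((F x : ℝ) : EReal)) (E x + c)
      = ⨆ z : X, (((⟪E x + c, z⟫ - F z : ℝ)) : EReal) := by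
    unfold fenchelConj
    simp [EReal.coe_sub]
  rw [key]
  have hne : (⨆ z : X, (((⟪E x + c, z⟫ - F z : ℝ)) : EReal)) ≠ ⊥ := by
    intro h
    have := le_iSup (fun z : X => (((⟪E x + c, z⟫ - F z : ℝ)) : EReal)) 0
    rw [h] at this
    simp only [le_bot_iff] at this
    exact EReal.coe_ne_bot _ this
  constructor
  · intro h
    generalize hS : (⨆ z : X, (((⟪E x + c, z⟫ - F z : ℝ)) : EReal)) = S at h hne
    induction S using EReal.rec with
    | bot => exact absurd rfl hne
    | top =>
      rw [EReal.mul_top_of_pos (by exact_mod_cast hτ)] at h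
      simp at h
    | coe r =>
      have h' : F x = τ * r + ⟪w, x⟫ + β := by
        beta_reduce at h
        exact_mod_cast h
      have hr : (F x - ⟪w, x⟫ - β) / τ = r := by rw [h']; field_simp; ring
      rw [hr]
      constructor
      · rintro _ ⟨z, rfl⟩
        have := le_iSup (fun z : X => (((⟪E x + c, z⟫ - F z : ℝ)) : EReal)) z
        rw [hS] at this
        exact_mod_cast this
      · intro b hb
        have : (⨆ z : X, (((⟪E x + c, z⟫ - F z : ℝ)) : EReal)) ≤ (b : EReal) :=
          iSup_le fun z => by exact_mod_cast hb ⟨z, rfl⟩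
        rw [hS] at this
        exact_mod_cast this
  · intro h
    have hS : (⨆ z : X, (((⟪E x + c, z⟫ - F z : ℝ)) : EReal))
        = (((F x - ⟪w, x⟫ - β) / τ : ℝ) : EReal) := by
      apply le_antisymm
      · exact iSup_le fun z => by exact_mod_cast h.1 ⟨z, rfl⟩
      · generalize hS : (⨆ z : X, (((⟪E x + c, z⟫ - F z : ℝ)) : EReal)) = S at hne
        induction S using EReal.rec with
        | bot => exact absurd rfl hne
        | top => exact le_top
        | coe r =>
          have : (F x - ⟪w, x⟫ - β) / τ ≤ r := by
            apply h.2
            rintro _ ⟨z, rfl⟩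
            have := le_iSup (fun z : X => (((⟪E x + c, z⟫ - F z : ℝ)) : EReal)) z
            rw [hS] at this
            exact_mod_cast this
          exact_mod_cast this
    rw [hS]
    have : F x = τ * ((F x - ⟪w, x⟫ - β) / τ) + ⟪w, x⟫ + β := by field_simp; ring
    beta_reduce
    exact_mod_cast this

/-- the constant of `pFun` -/
noncomputable def gam {X : Type*} [NormedAddCommGroup X] [InnerProductSpace ℝ X]
    (τ : ℝ) (c w : X) (β : ℝ) (E : X ≃L[ℝ] X) : ℝ :=
  (β + Real.sqrt τ / 2 * (1 + Real.sqrt τ)⁻¹ ^ 2 * ⟪E (E.symm (c - w)), E.symm (c - w)⟫)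
    / (τ + 1)

lemma pFun_eq {X : Type*} [NormedAddCommGroup X] [InnerProductSpace ℝ X]
    (τ : ℝ) (hτ : 0 < τ) (c w : X) (β : ℝ) (E : X ≃L[ℝ] X) (x : X) :
    pFun τ c w β E x = Real.sqrt τ / 2 * ⟪E x, x⟫ + ⟪w, x⟫
      + Real.sqrt τ * (1 + Real.sqrt τ)⁻¹ * ⟪E (E.symm (c - w)), x⟫ + gam τ c w β E := by
  have hs : 0 < Real.sqrt τ := Real.sqrt_pos.2 hτ
  unfold pFun gam
  rw [E.apply_symm_apply]
  simp only [inner_smul_left, inner_add_left, inner_sub_left, conj_trivial]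
  field_simp
  ring

lemma p_solves {X : Type*} [NormedAddCommGroup X] [InnerProductSpace ℝ X]
    (τ : ℝ) (hτ : 0 < τ) (c w : X) (β : ℝ) (E : X ≃L[ℝ] X)
    (hE_sa : ∀ x y : X, (⟪E x, y⟫ : ℝ) = ⟪x, E y⟫)
    (hE_pd : ∀ x : X, x ≠ 0 → 0 < (⟪E x, x⟫ : ℝ)) (x : X) :
    IsLUB (Set.range fun z => ⟪E x + c, z⟫ - pFun τ c w β E z)
      ((pFun τ c w β E x - ⟪w, x⟫ - β) / τ) := by
  have hs : 0 < Real.sqrt τ := Real.sqrt_pos.2 hτ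
  have hss : τ = Real.sqrt τ ^ 2 := (Real.sq_sqrt hτ.le).symm
  have hg : (τ + 1) * gam τ c w β E = β + Real.sqrt τ / 2 * (1 + Real.sqrt τ)⁻¹ ^ 2 * ⟪E (E.symm (c - w)), E.symm (c - w)⟫ := by
    unfold gam; field_simp
  simp only [pFun_eq τ hτ]
  generalize gam τ c w β E = γ at *
  have hc : c = w + E (E.symm (c - w)) := by simp
  generalize E.symm (c - w) = d at *
  subst hc
  generalize Real.sqrt τ = s at *
  subst hss
  set k : ℝ := (1 + s)⁻¹ with hk
  have hks : s * k = 1 - k := by rw [hk]; field_simp; ring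
  have hnn : ∀ u : X, 0 ≤ ⟪E u, u⟫ := fun u => by
    rcases eq_or_ne u 0 with rfl | h
    · simp
    · exact (hE_pd u h).le
  have hval : ((s / 2 * ⟪E x, x⟫ + ⟪w, x⟫ + s * k * ⟪E d, x⟫ + γ - ⟪w, x⟫ - β) / s ^ 2)
      = 1 / (2 * s) * ⟪E (x + k • d), x + k • d⟫ - γ := by
    have h1 : ⟪E x, d⟫ = ⟪E d, x⟫ := by rw [hE_sa, real_inner_comm]
    simp only [map_add, map_smul, inner_add_left, inner_add_right, inner_smul_left,
      inner_smul_right, conj_trivial, h1]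
    field_simp
    linear_combination 2 * hg
  rw [hval]
  have hexp : ∀ z, ⟪E x + (w + E d), z⟫ - (s / 2 * ⟪E z, z⟫ + ⟪w, z⟫ + s * k * ⟪E d, z⟫ + γ)
      = ⟪E (x + k • d), z⟫ - s / 2 * ⟪E z, z⟫ - γ := by
    intro z
    simp only [map_add, map_smul, inner_add_left, inner_smul_left, conj_trivial, hks]
    ring
  simp only [hexp]
  generalize x + k • d = q
  have hdiff : ∀ z, 1 / (2 * s) * ⟪E q, q⟫ - γ - (⟪E q, z⟫ - s / 2 * ⟪E z, z⟫ - γ)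
      = s / 2 * ⟪E (z - s⁻¹ • q), z - s⁻¹ • q⟫ := by
    intro z
    have h1 : ⟪E z, q⟫ = ⟪E q, z⟫ := by rw [hE_sa, real_inner_comm]
    simp only [map_sub, map_smul, inner_sub_left, inner_sub_right, inner_smul_left,
      inner_smul_right, conj_trivial, h1]
    field_simp
    ring
  constructor
  · rintro _ ⟨z, rfl⟩
    have := hdiff z
    have := mul_nonneg (half_pos hs).le (hnn (z - s⁻¹ • q))
    simp only
    linarith
  · intro b hb
    have h1 := hb ⟨s⁻¹ • q, rfl⟩
    have := hdiff (s⁻¹ • q)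
    simp at this h1 ⊢
    linarith

lemma p_strict {X : Type*} [NormedAddCommGroup X] [InnerProductSpace ℝ X]
    (τ : ℝ) (hτ : 0 < τ) (c w : X) (β : ℝ) (E : X ≃L[ℝ] X)
    (hE_sa : ∀ x y : X, (⟪E x, y⟫ : ℝ) = ⟪x, E y⟫)
    (hE_pd : ∀ x : X, x ≠ 0 → 0 < (⟪E x, x⟫ : ℝ)) :
    StrictConvexOn ℝ Set.univ (pFun τ c w β E) := by
  have hs : 0 < Real.sqrt τ := Real.sqrt_pos.2 hτ
  refine ⟨convex_univ, fun x _ y _ hxy a b ha hb hab => ?_⟩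
  have h := hE_pd (x - y) (sub_ne_zero.2 hxy)
  have h2 := mul_pos (half_pos hs) (mul_pos (mul_pos ha hb) h)
  simp only [pFun_eq τ hτ]
  have h1 : ⟪E y, x⟫ = ⟪E x, y⟫ := by rw [hE_sa, real_inner_comm]
  obtain rfl : b = 1 - a := by linarith
  simp only [map_add, map_sub, map_smul, inner_add_left, inner_add_right, inner_sub_left,
    inner_sub_right, inner_smul_left, inner_smul_right, conj_trivial, h1, smul_eq_mul] at h2 ⊢
  nlinarith

lemma p_contDiff {X : Type*} [NormedAddCommGroup X] [InnerProductSpace ℝ X]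
    (τ : ℝ) (c w : X) (β : ℝ) (E : X ≃L[ℝ] X) : ContDiff ℝ 3 (pFun τ c w β E) := by
  unfold pFun
  have : ContDiff ℝ 3 E := E.contDiff
  have h1 : ContDiff ℝ 3 (fun x => ⟪Real.sqrt τ • E x, x⟫) :=
    (this.const_smul _).inner ℝ contDiff_id
  have h2 : ContDiff ℝ 3 (fun x => ⟪(1 + Real.sqrt τ)⁻¹ • (w + Real.sqrt τ • c), x⟫) :=
    contDiff_const.inner ℝ contDiff_id
  exact ((contDiff_const.mul h1).add h2).add contDiff_const

lemma p_fderiv {X : Type*} [NormedAddCommGroup X] [InnerProductSpace ℝ X]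
    (τ : ℝ) (hτ : 0 < τ) (c w : X) (β : ℝ) (E : X ≃L[ℝ] X)
    (hE_sa : ∀ x y : X, (⟪E x, y⟫ : ℝ) = ⟪x, E y⟫) (x u : X) :
    fderiv ℝ (pFun τ c w β E) x u = ⟪Real.sqrt τ • E x + w
      + (Real.sqrt τ * (1 + Real.sqrt τ)⁻¹) • (c - w), u⟫ := by
  have hp : pFun τ c w β E = fun x => Real.sqrt τ / 2 * ⟪E x, x⟫ + ⟪w, x⟫
      + Real.sqrt τ * (1 + Real.sqrt τ)⁻¹ * ⟪(c - w), x⟫ + gam τ c w β E := by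
    funext x; rw [pFun_eq τ hτ, E.apply_symm_apply]
  have hid := hasFDerivAt_id (𝕜 := ℝ) x
  have h1 := (E.hasFDerivAt (x := x)).inner ℝ hid
  have h2 := (hasFDerivAt_const w x).inner ℝ hid
  have h3 := (hasFDerivAt_const (c - w) x).inner ℝ hid
  have h := (((h1.const_mul (Real.sqrt τ / 2)).add h2).add
    (h3.const_mul (Real.sqrt τ * (1 + Real.sqrt τ)⁻¹))).add_const (gam τ c w β E)
  rw [hp]
  refine (congrArg (fun L : X →L[ℝ] ℝ => L u) (HasFDerivAt.fderiv h)).trans ?_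
  have h4 : ⟪E u, x⟫ = ⟪E x, u⟫ := by rw [hE_sa, real_inner_comm]
  simp [fderivInnerCLM_apply, inner_add_left, inner_smul_left, h4]
  ring

lemma tangent {X : Type*} [NormedAddCommGroup X] [InnerProductSpace ℝ X]
    (F : X → ℝ) (hF : Differentiable ℝ F) (hc : ConvexOn ℝ Set.univ F) (x z : X) :
    F x + fderiv ℝ F x (z - x) ≤ F z := by
  have hl : ConvexOn ℝ Set.univ (F ∘ (AffineMap.lineMap x z : ℝ →ᵃ[ℝ] X)) := by
    simpa using hc.comp_affineMap (AffineMap.lineMap x z : ℝ →ᵃ[ℝ] X)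
  have hd : HasDerivAt (F ∘ (AffineMap.lineMap x z : ℝ →ᵃ[ℝ] X)) (fderiv ℝ F x (z - x)) 0 := by
    apply HasFDerivAt.comp_hasDerivAt (f := (AffineMap.lineMap x z : ℝ →ᵃ[ℝ] X))
    · simpa using (hF x).hasFDerivAt
    · exact AffineMap.hasDerivAt_lineMap
  have := hl.le_slope_of_hasDerivAt (Set.mem_univ 0) (Set.mem_univ 1) one_pos hd
  simp [slope_def_field] at this
  rw [map_sub]
  linarith

lemma homog {X : Type*} [NormedAddCommGroup X] [InnerProductSpace ℝ X]
    (S : X → X) (r : ℝ) (hr0 : 0 < r) (hr1 : r < 1) (h0 : S 0 = 0)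
    (hS : ∀ u, S (r • u) = r • S u) (A : X →L[ℝ] X) (hA : HasFDerivAt S A 0) (u : X) :
    S u = A u := by
  have hn : ∀ n : ℕ, S (r ^ n • u) = r ^ n • S u := by
    intro n
    induction n with
    | zero => simp
    | succ n ih => rw [pow_succ', mul_smul, hS, ih, mul_smul]
  have hd : HasDerivAt (fun t : ℝ => S (t • u)) (A u) 0 := by
    apply HasFDerivAt.comp_hasDerivAt (f := fun t : ℝ => t • u)
    · simpa using hA
    · simpa using (hasDerivAt_id (0 : ℝ)).smul_const u
  rw [hasDerivAt_iff_tendsto_slope] at hd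
  have ht : Filter.Tendsto (fun n : ℕ => r ^ n) Filter.atTop (nhdsWithin 0 {0}ᶜ) := by
    apply tendsto_nhdsWithin_of_tendsto_nhds_of_eventually_within
    · exact tendsto_pow_atTop_nhds_zero_of_lt_one hr0.le hr1
    · exact Filter.Eventually.of_forall fun n => (pow_pos hr0 n).ne'
  have h2 := hd.comp ht
  have h3 : (slope (fun t : ℝ => S (t • u)) 0 ∘ fun n : ℕ => r ^ n) = fun _ => S u := by
    funext n
    simp only [Function.comp, slope_def_module, hn, zero_smul, h0, sub_zero]
    rw [inv_smul_smul₀ (pow_pos hr0 n).ne']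
  rw [h3] at h2
  exact tendsto_nhds_unique tendsto_const_nhds h2

lemma fp_convex {X : Type*} [NormedAddCommGroup X] [InnerProductSpace ℝ X]
    (τ : ℝ) (hτ : 0 < τ) (c w : X) (β : ℝ) (E : X ≃L[ℝ] X) (F : X → ℝ)
    (h : ∀ x, IsLUB (Set.range fun z => ⟪E x + c, z⟫ - F z) ((F x - ⟪w, x⟫ - β) / τ)) :
    ConvexOn ℝ Set.univ F := by
  refine ⟨convex_univ, fun x _ y _ a b ha hb hab => ?_⟩
  have key : (F (a • x + b • y) - ⟪w, a • x + b • y⟫ - β) / τ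
      ≤ a * ((F x - ⟪w, x⟫ - β) / τ) + b * ((F y - ⟪w, y⟫ - β) / τ) := by
    apply (h _).2
    rintro _ ⟨z, rfl⟩
    have h1 := mul_le_mul_of_nonneg_left ((h x).1 ⟨z, rfl⟩) ha
    have h2 := mul_le_mul_of_nonneg_left ((h y).1 ⟨z, rfl⟩) hb
    obtain rfl : b = 1 - a := by linarith
    simp only [map_add, map_smul, inner_add_left, inner_smul_left, conj_trivial] at h1 h2 ⊢
    linarith
  obtain rfl : b = 1 - a := by linarith
  have e : a * ((F x - ⟪w, x⟫ - β) / τ) + (1 - a) * ((F y - ⟪w, y⟫ - β) / τ)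
    = (a * (F x - ⟪w, x⟫ - β) + (1 - a) * (F y - ⟪w, y⟫ - β)) / τ := by ring
  rw [e, div_le_div_iff_of_pos_right hτ] at key
  simp only [inner_add_right, inner_smul_right, smul_eq_mul] at key ⊢
  linarith

lemma uniq {X : Type*} [NormedAddCommGroup X] [InnerProductSpace ℝ X] [CompleteSpace X]
    (τ : ℝ) (hτ : 0 < τ) (hτ1 : τ ≠ 1) (c w : X) (β : ℝ) (E : X ≃L[ℝ] X)
    (hE_sa : ∀ x y : X, (⟪E x, y⟫ : ℝ) = ⟪x, E y⟫)
    (hE_pd : ∀ x : X, x ≠ 0 → 0 < (⟪E x, x⟫ : ℝ)) (F : X → ℝ)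
    (hF : Differentiable ℝ F) (hF2 : Differentiable ℝ (fderiv ℝ F))
    (h : ∀ x, IsLUB (Set.range fun z => ⟪E x + c, z⟫ - F z) ((F x - ⟪w, x⟫ - β) / τ)) :
    F = pFun τ c w β E := by
  have hs : 0 < Real.sqrt τ := Real.sqrt_pos.2 hτ
  have hss : Real.sqrt τ * Real.sqrt τ = τ := Real.mul_self_sqrt hτ.le
  have h1τ : 1 - τ ≠ 0 := sub_ne_zero.2 hτ1.symm
  have hconv := fp_convex τ hτ c w β E F h
  have htan := tangent F hF hconv
  -- the gradient
  obtain ⟨g, hg⟩ : ∃ g : X → X, g = fun x => (InnerProductSpace.toDual ℝ X).symm (fderiv ℝ F x) :=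
    ⟨_, rfl⟩
  have hgi : ∀ x u, ⟪g x, u⟫ = fderiv ℝ F x u := fun x u => by
    rw [hg]; exact InnerProductSpace.toDual_symm_apply
  have hgd : Differentiable ℝ g := by
    rw [hg]
    exact ((InnerProductSpace.toDual ℝ X).symm.toContinuousLinearEquiv.differentiable).comp hF2
  have hmono : ∀ x z, 0 ≤ ⟪g z - g x, z - x⟫ := fun x z => by
    have h1 := htan x z
    have h2 := htan z x
    rw [← hgi, inner_sub_right] at h1 h2
    simp only [inner_sub_left, inner_sub_right]
    linarith
  -- the functional equation
  obtain ⟨T, hT⟩ : ∃ T : X → X, T = fun x => E.symm (g x - c) := ⟨_, rfl⟩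
  have hET : ∀ x, E (T x) = g x - c := fun x => by rw [hT]; simp
  have hgT : ∀ x, g (T x) = w + τ • E x := by
    intro x
    have hle : ∀ u, 0 ≤ F u - ⟪w, u⟫ - β - τ * (⟪E u + c, x⟫ - F x) := fun u => by
      have := (h u).1 ⟨x, rfl⟩
      rw [le_div_iff₀ hτ] at this
      simp only at this
      linarith
    have heq : F (T x) - ⟪w, T x⟫ - β - τ * (⟪E (T x) + c, x⟫ - F x) ≤ 0 := by
      have : (F (T x) - ⟪w, T x⟫ - β) / τ ≤ ⟪E (T x) + c, x⟫ - F x := by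
        apply (h (T x)).2
        rintro _ ⟨z, rfl⟩
        have := htan x z
        rw [← hgi, inner_sub_right] at this
        simp only [hET, sub_add_cancel]
        linarith
      rw [div_le_iff₀ hτ] at this
      linarith
    have hmin : IsLocalMin (fun u => F u - ⟪w, u⟫ - β - τ * (⟪E u + c, x⟫ - F x)) (T x) :=
      Filter.Eventually.of_forall fun u => heq.trans (hle u)
    have hid := hasFDerivAt_id (𝕜 := ℝ) (T x)
    have d1 := (hF (T x)).hasFDerivAt
    have d2 := (hasFDerivAt_const w (T x)).inner ℝ hid
    have d3 := ((E.hasFDerivAt (x := T x)).add_const c).inner ℝ (hasFDerivAt_const x (T x))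
    have d := ((d1.sub d2).sub_const β).sub ((d3.sub_const (F x)).const_mul τ)
    have hz := hmin.hasFDerivAt_eq_zero d
    refine ext_inner_right ℝ fun u => ?_
    have hzu := congrArg (fun L : X →L[ℝ] ℝ => L u) hz
    simp [fderivInnerCLM_apply, ← hgi] at hzu
    have h4 : ⟪E u, x⟫ = ⟪E x, u⟫ := by rw [hE_sa, real_inner_comm]
    rw [inner_add_left, inner_smul_left, conj_trivial, ← h4]
    linarith
  have hTT : ∀ x, T (T x) = τ • x + E.symm (w - c) := fun x => by
    apply E.injective
    rw [hET, hgT]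
    simp
    abel
  obtain ⟨e, he⟩ : ∃ e, e = E.symm (w - c) := ⟨_, rfl⟩
  rw [← he] at hTT
  obtain ⟨x₀, hx₀⟩ : ∃ x₀ : X, x₀ = (1 - τ)⁻¹ • e := ⟨_, rfl⟩
  have hfix : ∀ x, τ • x + e = x ↔ x = x₀ := by
    intro x
    rw [hx₀, eq_inv_smul_iff₀ h1τ, sub_smul, one_smul, sub_eq_iff_eq_add]
    rw [add_comm, eq_comm]
  have he0 : e = x₀ - τ • x₀ := by
    have := (hfix x₀).2 rfl
    exact eq_sub_of_add_eq' this
  have hT0 : T x₀ = x₀ := by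
    rw [← hfix, ← hTT, hTT x₀, (hfix x₀).2 rfl]
  have hTd : Differentiable ℝ T := by
    rw [hT]
    exact E.symm.differentiable.comp (hgd.sub_const c)
  obtain ⟨S, hS⟩ : ∃ S : X → X, S = fun u => T (x₀ + u) - x₀ := ⟨_, rfl⟩
  have hSd : Differentiable ℝ S := by
    rw [hS]
    exact (hTd.comp ((differentiable_const x₀).add differentiable_id)).sub_const x₀
  have hS0 : S 0 = 0 := by simp [hS, hT0]
  have hSS : ∀ u, S (S u) = τ • u := fun u => by
    simp only [hS, add_sub_cancel, hTT, he0, smul_add]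
    abel
  have hSτ : ∀ u, S (τ • u) = τ • S u := fun u => by rw [← hSS, hSS (S u)]
  have hSτ' : ∀ u, S (τ⁻¹ • u) = τ⁻¹ • S u := fun u => by
    rw [eq_inv_smul_iff₀ hτ.ne', ← hSτ, smul_inv_smul₀ hτ.ne']
  have hA : ∀ u, S u = fderiv ℝ S 0 u := by
    rcases lt_or_gt_of_ne hτ1 with hlt | hgt
    · exact homog S τ hτ hlt hS0 hSτ _ (hSd 0).hasFDerivAt
    · exact homog S τ⁻¹ (inv_pos.2 hτ) (inv_lt_one_of_one_lt₀ hgt) hS0 hSτ' _ (hSd 0).hasFDerivAt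
  have hSpos : ∀ u, 0 ≤ ⟪E (S u), u⟫ := fun u => by
    have := hmono x₀ (x₀ + u)
    have e1 : g (x₀ + u) - g x₀ = E (S u) := by
      have a1 := hET (x₀ + u)
      have a2 := hET x₀
      rw [hT0] at a2
      simp only [hS, map_sub, a1, a2]
      abel
    rwa [e1, add_sub_cancel_left] at this
  have hSv : ∀ u, S u = Real.sqrt τ • u := by
    intro u
    by_contra hne
    have hv : S u - Real.sqrt τ • u ≠ 0 := sub_ne_zero.2 hne
    have e1 : S (S u - Real.sqrt τ • u) = -(Real.sqrt τ • (S u - Real.sqrt τ • u)) := by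
      rw [hA (S u - _), map_sub, map_smul, ← hA, ← hA, hSS, smul_sub, smul_smul, hss]
      abel
    have e2 := hSpos (S u - Real.sqrt τ • u)
    rw [e1, map_neg, map_smul, inner_neg_left, inner_smul_left, conj_trivial] at e2
    have := mul_pos hs (hE_pd _ hv)
    linarith
  have hgx : ∀ x, g x = Real.sqrt τ • E x + w
      + (Real.sqrt τ * (1 + Real.sqrt τ)⁻¹) • (c - w) := by
    intro x
    have e1 : T x = x₀ + Real.sqrt τ • (x - x₀) := by
      rw [← hSv]; simp [hS]
    have e2 := hET x
    have e3 : E x₀ = (1 - τ)⁻¹ • (w - c) := by rw [hx₀, he]; simp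
    have e4 : g x = E (T x) + c := by rw [e2]; abel
    have e5 : (1 - Real.sqrt τ) * (1 - τ)⁻¹ = (1 + Real.sqrt τ)⁻¹ := by
      have : (1 - τ) = (1 - Real.sqrt τ) * (1 + Real.sqrt τ) := by linear_combination hss
      have h6 : 1 - Real.sqrt τ ≠ 0 := fun h0 => h1τ (by rw [this, h0, zero_mul])
      rw [this]; field_simp
    have e6 : Real.sqrt τ * (1 + Real.sqrt τ)⁻¹ = 1 - (1 + Real.sqrt τ)⁻¹ := by
      field_simp; ring
    rw [e4, e1, map_add, map_smul, map_sub, e3, e6, ← e5]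
    module
  -- equality up to constants
  have hpd : Differentiable ℝ (pFun τ c w β E) := (p_contDiff τ c w β E).differentiable (by norm_num)
  have hconst : ∀ x, F x - pFun τ c w β E x = F 0 - pFun τ c w β E 0 := by
    intro x
    refine is_const_of_fderiv_eq_zero (𝕜 := ℝ) (f := fun x => F x - pFun τ c w β E x)
      (hF.sub hpd) (fun y => ?_) x 0
    ext u
    rw [fderiv_fun_sub (hF y) (hpd y)]
    simp only [sub_apply, p_fderiv τ hτ c w β E hE_sa, ← hgi, hgx, sub_self,
      zero_apply]
  obtain ⟨k, hk⟩ : ∃ k, k = F 0 - pFun τ c w β E 0 := ⟨_, rfl⟩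
  rw [← hk] at hconst
  have hFp : ∀ x, F x = pFun τ c w β E x + k := fun x => by rw [← hconst x]; ring
  have hp0 := p_solves τ hτ c w β E hE_sa hE_pd 0
  have hF0 := h 0
  have i1 : (F 0 - ⟪w, 0⟫ - β) / τ ≤ (pFun τ c w β E 0 - ⟪w, 0⟫ - β) / τ - k := by
    apply hF0.2
    rintro _ ⟨z, rfl⟩
    have := hp0.1 ⟨z, rfl⟩
    simp only [hFp z] at this ⊢
    linarith
  have i2 : (pFun τ c w β E 0 - ⟪w, 0⟫ - β) / τ ≤ (F 0 - ⟪w, 0⟫ - β) / τ + k := by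
    apply hp0.2
    rintro _ ⟨z, rfl⟩
    have := hF0.1 ⟨z, rfl⟩
    simp only [hFp z] at this ⊢
    linarith
  have i3 : (F 0 - ⟪w, 0⟫ - β) / τ = (pFun τ c w β E 0 - ⟪w, 0⟫ - β) / τ - k := by linarith
  rw [hFp 0] at i3
  field_simp at i3
  have hk0 : k = 0 := by
    have : k * (1 + τ) = 0 := by linarith
    rcases mul_eq_zero.1 this with h | h
    · exact h
    · linarith
  funext x
  rw [hFp, hk0, add_zero]

/-- in a finite-dimensional real Hilbert space, if `E` is positive definite
and `0 < τ ≠ 1`, then (FP) has exactly one solution in the class of real-valued functions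
which are twice differentiable with second derivative continuous at
`x₀ = (1/(1−τ))(E⁻¹w − E⁻¹c)`, namely the strictly convex quadratic function `pFun`. -/
theorem unique_solution_in_twice_differentiable_class_finite_dim
    {X : Type*} [NormedAddCommGroup X] [InnerProductSpace ℝ X] [CompleteSpace X] [Nontrivial X]
    [FiniteDimensional ℝ X]
    (τ : ℝ) (hτ : 0 < τ) (hτ1 : τ ≠ 1) (c w : X) (β : ℝ) (E : X ≃L[ℝ] X)
    (hE_sa : ∀ x y : X, (⟪E x, y⟫ : ℝ) = ⟪x, E y⟫)
    (hE_pd : ∀ x : X, x ≠ 0 → 0 < (⟪E x, x⟫ : ℝ)) :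
    (Differentiable ℝ (pFun τ c w β E) ∧
      Differentiable ℝ (fderiv ℝ (pFun τ c w β E)) ∧
      ContinuousAt (fderiv ℝ (fderiv ℝ (pFun τ c w β E)))
        ((1 / (1 - τ)) • (E.symm w - E.symm c)) ∧
      SolvesFP τ c w β E (fun x => ((pFun τ c w β E x : ℝ) : EReal)) ∧
      StrictConvexOn ℝ Set.univ (pFun τ c w β E)) ∧
    ∀ F : X → ℝ,
      Differentiable ℝ F →
      Differentiable ℝ (fderiv ℝ F) →
      ContinuousAt (fderiv ℝ (fderiv ℝ F)) ((1 / (1 - τ)) • (E.symm w - E.symm c)) →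
      SolvesFP τ c w β E (fun x => ((F x : ℝ) : EReal)) →
      F = pFun τ c w β E := by
  have hC := p_contDiff τ c w β E
  have hC1 : ContDiff ℝ 2 (fderiv ℝ (pFun τ c w β E)) := hC.fderiv_right (by norm_num)
  have hC2 : ContDiff ℝ 1 (fderiv ℝ (fderiv ℝ (pFun τ c w β E))) := hC1.fderiv_right (by norm_num)
  refine ⟨⟨hC.differentiable (by norm_num), hC1.differentiable (by norm_num),
    hC2.continuous.continuousAt, ?_, p_strict τ hτ c w β E hE_sa hE_pd⟩, ?_⟩
  · exact (fp_iff τ hτ c w β E _).2 (p_solves τ hτ c w β E hE_sa hE_pd)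
  · intro F hF hF2 _ h
    exact uniq τ hτ hτ1 c w β E hE_sa hE_pd F hF hF2 ((fp_iff τ hτ c w β E F).1 h)
end

section
/- Let X = ℝⁿ (n ≥ 1) with the standard inner product, let τ > 0, c, w ∈ ℝⁿ, β ∈ ℝ, and let E : ℝⁿ → ℝⁿ be an invertible self-adjoint (symmetric) linear operator. Write E = U D U⁻¹ with U orthogonal and D diagonal with nonzero diagonal entries d₁, …, dₙ, and set A := √τ·U·|D|·U⁻¹, where |D| is the diagonal matrix with entries |d₁|, …, |dₙ|. Suppose b ∈ ℝⁿ satisfies (τEA⁻¹ + I)b = w + τEA⁻¹c, and set γ := (β + (τ/2)⟨c − b, A⁻¹(c − b)⟩)/(τ + 1). Then f(x) := (1/2)⟨Ax, x⟩ + ⟨b, x⟩ + γ solves the fixed point equation (FP). In particular, if w = −τEA⁻¹c (e.g., if c = w = 0), then f(x) := (1/2)⟨Ax, x⟩ + (β + (τ/2)⟨c, A⁻¹c⟩)/(τ + 1) solves (FP). -/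
open Matrix

/-- The Legendre–Fenchel conjugate of an extended-real-valued function on `ℝⁿ` (with the
standard inner product `⟪y, x⟫ = ∑ i, y i * x i`): `f*(y) = sup_x (⟪y, x⟫ - f x)`. -/
noncomputable def fenchelConjn {n : ℕ} (f : (Fin n → ℝ) → EReal) : (Fin n → ℝ) → EReal :=
  fun y => ⨆ x : Fin n → ℝ, ((y ⬝ᵥ x : ℝ) : EReal) - f x

/-- `f` solves the fixed point equation (FP) on `ℝⁿ`:
`f x = τ · f*(E x + c) + ⟪w, x⟫ + β` for every `x`. -/
def SolvesFPn {n : ℕ} (τ : ℝ) (c w : Fin n → ℝ) (β : ℝ)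
    (E : Matrix (Fin n) (Fin n) ℝ) (f : (Fin n → ℝ) → EReal) : Prop :=
  ∀ x : Fin n → ℝ,
    f x = (τ : EReal) * fenchelConjn f (E.mulVec x + c) + ((w ⬝ᵥ x : ℝ) : EReal) + (β : EReal)

lemma aux_conj_s18 {n : ℕ} (A B : Matrix (Fin n) (Fin n) ℝ) (hAB : A * B = 1) (hAs : Aᵀ = A)
    (hpos : ∀ z : Fin n → ℝ, 0 ≤ A.mulVec z ⬝ᵥ z) (b : Fin n → ℝ) (γ : ℝ)
    (f : (Fin n → ℝ) → EReal)
    (hf : ∀ x : Fin n → ℝ,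
      f x = (((1 : ℝ) / 2 * (A.mulVec x ⬝ᵥ x) + b ⬝ᵥ x + γ : ℝ) : EReal)) (y : Fin n → ℝ) :
    fenchelConjn f y = ((1 / 2 * ((y - b) ⬝ᵥ B.mulVec (y - b)) - γ : ℝ) : EReal) := by
  have key : ∀ x : Fin n → ℝ, y ⬝ᵥ x - ((1 : ℝ) / 2 * (A.mulVec x ⬝ᵥ x) + b ⬝ᵥ x + γ)
      = 1 / 2 * ((y - b) ⬝ᵥ B.mulVec (y - b)) - γ
        - 1 / 2 * (A.mulVec (x - B.mulVec (y - b)) ⬝ᵥ (x - B.mulVec (y - b))) := by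
    intro x
    have h1 : A.mulVec (B.mulVec (y - b)) = y - b := by
      rw [mulVec_mulVec, hAB, one_mulVec]
    have h2 : A.mulVec x ⬝ᵥ B.mulVec (y - b) = (y - b) ⬝ᵥ x := by
      rw [dotProduct_comm, dotProduct_mulVec, ← mulVec_transpose, hAs, h1]
    simp only [mulVec_sub A, h1, sub_dotProduct (A.mulVec x), dotProduct_sub, h2, sub_dotProduct y b x]
    ring
  unfold fenchelConjn
  apply le_antisymm
  · apply iSup_le
    intro x
    rw [hf, ← EReal.coe_sub, EReal.coe_le_coe_iff, key]
    linarith [hpos (x - B.mulVec (y - b))]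
  · refine le_trans (le_of_eq ?_) (le_iSup _ (B.mulVec (y - b)))
    rw [hf, ← EReal.coe_sub, key]
    simp

lemma aux_main {n : ℕ} (τ : ℝ) (hτ : 0 < τ) (c w : Fin n → ℝ) (β : ℝ)
    (E A B : Matrix (Fin n) (Fin n) ℝ) (hAB : A * B = 1) (hAs : Aᵀ = A) (hBs : Bᵀ = B)
    (hEs : Eᵀ = E) (hEBE : τ • (E * B * E) = A)
    (hpos : ∀ z : Fin n → ℝ, 0 ≤ A.mulVec z ⬝ᵥ z) (b : Fin n → ℝ)
    (hb : (τ • (E * B) + 1).mulVec b = w + (τ • (E * B)).mulVec c) (γ : ℝ)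
    (hγ : γ = (β + τ / 2 * ((c - b) ⬝ᵥ B.mulVec (c - b))) / (τ + 1))
    (f : (Fin n → ℝ) → EReal)
    (hf : ∀ x : Fin n → ℝ,
      f x = (((1 : ℝ) / 2 * (A.mulVec x ⬝ᵥ x) + b ⬝ᵥ x + γ : ℝ) : EReal)) :
    SolvesFPn τ c w β E f := by
  intro x
  rw [aux_conj_s18 A B hAB hAs hpos b γ f hf, hf, ← EReal.coe_mul, ← EReal.coe_add, ← EReal.coe_add,
    EReal.coe_eq_coe_iff, add_sub_assoc]
  have hw : w = b - τ • E.mulVec (B.mulVec (c - b)) := by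
    rw [add_mulVec, one_mulVec] at hb
    rw [mulVec_mulVec, mulVec_sub, smul_sub, ← smul_mulVec, ← smul_mulVec]
    rw [eq_sub_of_add_eq hb.symm]
    abel
  generalize c - b = v at *
  have hγ2 : γ * (τ + 1) = β + τ / 2 * (v ⬝ᵥ B.mulVec v) := by
    rw [hγ]; field_simp
  have e1 : A.mulVec x ⬝ᵥ x = τ * (E.mulVec x ⬝ᵥ B.mulVec (E.mulVec x)) := by
    rw [← hEBE, smul_mulVec, smul_dotProduct, smul_eq_mul, ← mulVec_mulVec, ← mulVec_mulVec,
      dotProduct_comm _ x, dotProduct_mulVec x E, ← mulVec_transpose, hEs]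
  have e2 : v ⬝ᵥ B.mulVec (E.mulVec x) = E.mulVec x ⬝ᵥ B.mulVec v := by
    rw [dotProduct_mulVec, ← mulVec_transpose, hBs, dotProduct_comm]
  have e3 : E.mulVec (B.mulVec v) ⬝ᵥ x = E.mulVec x ⬝ᵥ B.mulVec v := by
    rw [dotProduct_comm, dotProduct_mulVec, ← mulVec_transpose, hEs]
  rw [hw, mulVec_add, add_dotProduct, dotProduct_add, dotProduct_add, e1, e2, sub_dotProduct,
    smul_dotProduct, e3, smul_eq_mul]
  linarith

/-- on `ℝⁿ` (`n ≥ 1`), for an invertible symmetric `E = U D U⁻¹` (with `U`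
orthogonal and `D = diagonal d`, `d i ≠ 0`), setting `A := √τ·U·|D|·U⁻¹`, if `b` solves
`(τEA⁻¹ + I)b = w + τEA⁻¹c` and `γ := (β + (τ/2)⟪c − b, A⁻¹(c − b)⟫)/(τ + 1)`, then
`f(x) = (1/2)⟪Ax, x⟫ + ⟪b, x⟫ + γ` solves (FP). In particular, if `w = −τEA⁻¹c` then
`f(x) = (1/2)⟪Ax, x⟫ + (β + (τ/2)⟪c, A⁻¹c⟫)/(τ + 1)` solves (FP). -/
theorem existence_for_symmetric_not_positive_definite
    {n : ℕ} (hn : 1 ≤ n) (τ : ℝ) (hτ : 0 < τ) (c w : Fin n → ℝ) (β : ℝ)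
    (U : Matrix (Fin n) (Fin n) ℝ) (hU : U * Uᵀ = 1 ∧ Uᵀ * U = 1)
    (d : Fin n → ℝ) (hd : ∀ i, d i ≠ 0)
    (E : Matrix (Fin n) (Fin n) ℝ) (hE : E = U * Matrix.diagonal d * U⁻¹)
    (hEunit : IsUnit E) (hEsymm : Eᵀ = E)
    (A : Matrix (Fin n) (Fin n) ℝ)
    (hA : A = Real.sqrt τ • (U * Matrix.diagonal (fun i => |d i|) * U⁻¹))
    (b : Fin n → ℝ)
    (hb : (τ • (E * A⁻¹) + 1).mulVec b = w + (τ • (E * A⁻¹)).mulVec c)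
    (γ : ℝ)
    (hγ : γ = (β + τ / 2 * ((c - b) ⬝ᵥ A⁻¹.mulVec (c - b))) / (τ + 1))
    (f : (Fin n → ℝ) → EReal)
    (hf : ∀ x : Fin n → ℝ,
      f x = (((1 : ℝ) / 2 * (A.mulVec x ⬝ᵥ x) + b ⬝ᵥ x + γ : ℝ) : EReal)) :
    SolvesFPn τ c w β E f ∧
      (w = -(τ • (E * A⁻¹)).mulVec c →
        ∀ g : (Fin n → ℝ) → EReal,
          (∀ x : Fin n → ℝ,
            g x = (((1 : ℝ) / 2 * (A.mulVec x ⬝ᵥ x)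
              + (β + τ / 2 * (c ⬝ᵥ A⁻¹.mulVec c)) / (τ + 1) : ℝ) : EReal)) →
          SolvesFPn τ c w β E g) := by
  obtain ⟨hU1, hU2⟩ := hU
  have hUi : U⁻¹ = Uᵀ := inv_eq_right_inv hU1
  rw [hUi] at hE hA
  have hs : Real.sqrt τ ≠ 0 := (Real.sqrt_pos.2 hτ).ne'
  have hss : Real.sqrt τ * Real.sqrt τ = τ := Real.mul_self_sqrt hτ.le
  have conj : ∀ p q : Fin n → ℝ, (U * diagonal p * Uᵀ) * (U * diagonal q * Uᵀ)
      = U * diagonal (fun i => p i * q i) * Uᵀ := by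
    intro p q
    rw [← diagonal_mul_diagonal]
    calc _ = U * diagonal p * (Uᵀ * U) * diagonal q * Uᵀ := by simp only [Matrix.mul_assoc]
      _ = _ := by rw [hU2]; simp only [Matrix.mul_assoc, Matrix.one_mul]
  have csymm : ∀ p : Fin n → ℝ, (U * diagonal p * Uᵀ)ᵀ = U * diagonal p * Uᵀ := by
    intro p
    simp only [transpose_mul, transpose_transpose, diagonal_transpose, Matrix.mul_assoc]
  obtain ⟨B, hB⟩ : ∃ B, B = (Real.sqrt τ)⁻¹ • (U * diagonal (fun i => |d i|⁻¹) * Uᵀ) := ⟨_, rfl⟩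
  have hAB : A * B = 1 := by
    rw [hA, hB, smul_mul_smul_comm, conj, mul_inv_cancel₀ hs, one_smul]
    have : (fun i => |d i| * |d i|⁻¹) = fun _ => (1 : ℝ) := by
      funext i
      exact mul_inv_cancel₀ (abs_ne_zero.2 (hd i))
    rw [this, diagonal_one, Matrix.mul_one, hU1]
  have hAinv : A⁻¹ = B := inv_eq_right_inv hAB
  have hAs : Aᵀ = A := by rw [hA, transpose_smul, csymm]
  have hBs : Bᵀ = B := by rw [hB, transpose_smul, csymm]
  have hEBE : τ • (E * B * E) = A := by
    rw [hE, hB, hA, Matrix.mul_smul, conj, Matrix.smul_mul, conj, smul_smul]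
    have h1 : τ * (Real.sqrt τ)⁻¹ = Real.sqrt τ := by
      rw [← div_eq_mul_inv, Real.div_sqrt]
    have h2 : (fun i => d i * |d i|⁻¹ * d i) = fun i => |d i| := by
      funext i
      have := abs_ne_zero.2 (hd i)
      field_simp
      exact (sq_abs _).symm
    rw [h1, h2]
  have hpos : ∀ z : Fin n → ℝ, 0 ≤ A.mulVec z ⬝ᵥ z := by
    intro z
    rw [hA, smul_mulVec, smul_dotProduct, smul_eq_mul]
    apply mul_nonneg (Real.sqrt_nonneg _)
    rw [← mulVec_mulVec, ← mulVec_mulVec, dotProduct_comm, dotProduct_mulVec, ← mulVec_transpose]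
    apply Finset.sum_nonneg
    intro i _
    rw [mulVec_diagonal, mul_left_comm]
    exact mul_nonneg (abs_nonneg _) (mul_self_nonneg _)
  rw [hAinv] at hb hγ ⊢
  refine ⟨aux_main τ hτ c w β E A B hAB hAs hBs hEsymm hEBE hpos b hb γ hγ f hf, ?_⟩
  intro hw g hg
  refine aux_main τ hτ c w β E A B hAB hAs hBs hEsymm hEBE hpos 0 ?_ _ rfl g ?_
  · rw [hw, mulVec_zero, neg_add_cancel]
  · intro x
    rw [hg x]
    simp
end
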